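/- arXiv:1610.01583 — 4 statements merged into one kernel-verified Lean document; each statement's English description precedes it below -/
import Mathlib

section
/- The Riemann Hypothesis is true if and only if ζ(s) ≡ η(s) (i.e., the Riemann zeta function and the function η agree identically as meromorphic functions on ℂ). -/
open Complex Filter Topology

/-- `h(s) = (1/2) ∏_ν (1 - (s - s²)/|s_ν|²)`. -/
noncomputable def hfun (sν : ℕ → ℂ) (s : ℂ) : ℂ :=
  (1 / 2 : ℂ) * ∏' ν : ℕ, (1 - (s - s ^ 2) / ((‖sν ν‖ : ℂ) ^ 2))

/-- `f` has a zero of exact order `m` at `z` (order `0` meaning `f` is nonvanishing near `z`). -/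
def ZeroOfOrder (f : ℂ → ℂ) (z : ℂ) (m : ℕ) : Prop :=
  ∃ g : ℂ → ℂ, AnalyticAt ℂ g z ∧ g z ≠ 0 ∧
    ∀ᶠ w in 𝓝[≠] z, f w = (w - z) ^ m * g w

/-- `sν` enumerates, counted with multiplicity, the zeros of `f` with `Re = 1/2`, `Im > 0`. -/
def CriticalZeroEnumFor (f : ℂ → ℂ) (sν : ℕ → ℂ) : Prop :=
  (∀ ν, (sν ν).re = 1 / 2 ∧ 0 < (sν ν).im ∧ f (sν ν) = 0) ∧
  ∀ z : ℂ, z.re = 1 / 2 → 0 < z.im → f z = 0 →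
    ZeroOfOrder f z (Nat.card {ν : ℕ // sν ν = z})

/-- `η`, defined by `h(s) = (s/2)(s-1)π^{-s/2}Γ(s/2)η(s)`. -/
noncomputable def etaFun (sν : ℕ → ℂ) (s : ℂ) : ℂ :=
  hfun sν s / (s / 2 * (s - 1) * (Real.pi : ℂ) ^ (-s / 2) * Complex.Gamma (s / 2))

open HurwitzZeta MeasureTheory Set in
lemma exists_completedRiemannZeta₀_eq_mellin :
    ∃ φ : ℝ → ℝ, (∀ x, 0 < x → 0 ≤ φ x) ∧
      ∀ s : ℂ, IntegrableOn (fun x : ℝ ↦ x ^ (s.re / 2 - 1) * φ x) (Ioi 0) ∧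
      completedRiemannZeta₀ s = (∫ x : ℝ in Ioi 0, (x : ℂ) ^ (s / 2 - 1) * (φ x : ℂ)) / 2 := by
  set P := hurwitzEvenFEPair 0 with hP
  have hreal : ∀ x : ℝ, 0 < x → ∃ r : ℝ, 0 ≤ r ∧ P.f_modif x = r := by
    have hpos : ∀ x : ℝ, 0 < x → 0 ≤ evenKernel 0 x - 1 := by
      intro x hx
      have := hasSum_int_evenKernel₀ 0 hx
      simp only [QuotientAddGroup.mk_zero, if_true] at this
      refine this.nonneg fun n ↦ ?_
      split_ifs
      · exact le_rfl
      · positivity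
    intro x hx
    rcases lt_trichotomy 1 x with h1 | h1 | h1
    · refine ⟨evenKernel 0 x - 1, hpos x hx, ?_⟩
      simp [WeakFEPair.f_modif, h1, h1.le, hP, hurwitzEvenFEPair]
    · refine ⟨0, le_rfl, ?_⟩
      simp [WeakFEPair.f_modif, ← h1]
    · refine ⟨x ^ (-(1 / 2) : ℝ) * (evenKernel 0 (1 / x) - 1),
        mul_nonneg (by positivity) (hpos _ (by positivity)), ?_⟩
      have h2 := evenKernel_functional_equation 0 x
      rw [← evenKernel_eq_cosKernel_of_zero, one_div (x ^ (1 / 2 : ℝ)), ← Real.rpow_neg hx.le] at h2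
      simp [WeakFEPair.f_modif, h1, h1.le, hx, hP, hurwitzEvenFEPair]
      norm_num at h2
      rw [h2]
      push_cast
      ring_nf
  choose! φ hφ0 hφ using hreal
  refine ⟨φ, hφ0, fun s ↦ ?_⟩
  have hm := P.isStrongFEPair_toStrongFEPair.hasMellin (s / 2)
  have hc : IntegrableOn (fun x : ℝ ↦ (x : ℂ) ^ (s / 2 - 1) • P.f_modif x) (Ioi 0) := hm.1
  constructor
  · have hn : IntegrableOn (fun x : ℝ ↦ ‖(x : ℂ) ^ (s / 2 - 1) • P.f_modif x‖) (Ioi 0) := hc.norm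
    refine hn.congr_fun (fun x hx ↦ ?_) measurableSet_Ioi
    have hx' : 0 < x := hx
    simp only [norm_smul]
    rw [hφ x hx', norm_cpow_eq_rpow_re_of_pos hx', norm_real, Real.norm_of_nonneg (hφ0 x hx')]
    simp
  · have : completedRiemannZeta₀ s = mellin P.f_modif (s / 2) / 2 := rfl
    rw [this, mellin]
    congr 1
    refine setIntegral_congr_fun measurableSet_Ioi fun x hx ↦ ?_
    simp only [smul_eq_mul]
    rw [hφ x hx]

open MeasureTheory Set in
lemma norm_completedRiemannZeta₀_le {s : ℂ} {a : ℝ} (h1 : 1 - a ≤ s.re) (h2 : s.re ≤ a) :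
    ‖completedRiemannZeta₀ s‖ ≤ 2 * ‖completedRiemannZeta₀ a‖ := by
  obtain ⟨φ, hφ0, hφ⟩ := exists_completedRiemannZeta₀_eq_mellin
  have hr : ∀ b : ℝ, ‖completedRiemannZeta₀ b‖ =
      (∫ x : ℝ in Ioi 0, x ^ (b / 2 - 1) * φ x) / 2 := by
    intro b
    have h : ∫ x : ℝ in Ioi 0, (x : ℂ) ^ ((b : ℂ) / 2 - 1) * (φ x : ℂ) =
        ((∫ x : ℝ in Ioi 0, x ^ (b / 2 - 1) * φ x : ℝ) : ℂ) := by
      refine Eq.trans ?_ integral_ofReal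
      refine setIntegral_congr_fun measurableSet_Ioi fun x hx ↦ ?_
      have hx' : (0 : ℝ) < x := hx
      simp [ofReal_cpow hx'.le]
    rw [(hφ b).2, h, norm_div, norm_real, Real.norm_of_nonneg]
    · simp
    · exact setIntegral_nonneg measurableSet_Ioi fun x hx ↦
        mul_nonneg (Real.rpow_nonneg (le_of_lt hx) _) (hφ0 x hx)
  have hsymm : ‖completedRiemannZeta₀ (1 - a : ℝ)‖ = ‖completedRiemannZeta₀ a‖ := by
    push_cast
    rw [completedRiemannZeta₀_one_sub]
  calc ‖completedRiemannZeta₀ s‖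
      = ‖∫ x : ℝ in Ioi 0, (x : ℂ) ^ (s / 2 - 1) * (φ x : ℂ)‖ / 2 := by
        rw [(hφ s).2, norm_div]; simp
    _ ≤ (∫ x : ℝ in Ioi 0, x ^ (s.re / 2 - 1) * φ x) / 2 := by
        gcongr
        refine norm_integral_le_integral_norm _ |>.trans_eq ?_
        refine setIntegral_congr_fun measurableSet_Ioi fun x hx ↦ ?_
        have hx' : (0 : ℝ) < x := hx
        simp only [norm_mul, norm_cpow_eq_rpow_re_of_pos hx', norm_real,
          Real.norm_of_nonneg (hφ0 x hx')]
        simp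
    _ ≤ (∫ x : ℝ in Ioi 0, (x ^ (a / 2 - 1) * φ x + x ^ ((1 - a) / 2 - 1) * φ x)) / 2 := by
        have i1 := (hφ (a : ℝ)).1
        have i2 := (hφ ((1 - a : ℝ) : ℂ)).1
        rw [ofReal_re] at i1 i2
        refine div_le_div_of_nonneg_right
          (setIntegral_mono_on (hφ s).1 (i1.add i2) measurableSet_Ioi fun x hx ↦ ?_) two_pos.le
        have hx' : (0 : ℝ) < x := hx
        have p1 : 0 < x ^ (a / 2 - 1) := by positivity
        have p2 : 0 < x ^ ((1 - a) / 2 - 1) := by positivity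
        change x ^ (s.re / 2 - 1) * φ x ≤ x ^ (a / 2 - 1) * φ x + x ^ ((1 - a) / 2 - 1) * φ x
        rw [← add_mul]
        gcongr
        · exact hφ0 x hx'
        rcases le_total 1 x with h | h
        · have : x ^ (s.re / 2 - 1) ≤ x ^ (a / 2 - 1) :=
            Real.rpow_le_rpow_of_exponent_le h (by linarith)
          linarith
        · have : x ^ (s.re / 2 - 1) ≤ x ^ ((1 - a) / 2 - 1) :=
            Real.rpow_le_rpow_of_exponent_ge hx' h (by linarith)
          linarith
    _ = ‖completedRiemannZeta₀ a‖ + ‖completedRiemannZeta₀ (1 - a : ℝ)‖ := by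
        have i1 := (hφ (a : ℝ)).1
        have i2 := (hφ ((1 - a : ℝ) : ℂ)).1
        rw [ofReal_re] at i1 i2
        rw [hr, hr, integral_add i1 i2, add_div]
    _ = 2 * ‖completedRiemannZeta₀ a‖ := by rw [hsymm]; ring

lemma completedRiemannZeta₀_two_mul_nat {n : ℕ} (hn : 1 ≤ n) :
    completedRiemannZeta₀ (2 * n) =
      (Real.pi : ℂ)⁻¹ ^ n * (n - 1).factorial * riemannZeta (2 * n) + 1 / (2 * n) +
        1 / (1 - 2 * n) := by
  obtain ⟨m, rfl⟩ := Nat.exists_eq_add_of_le' hn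
  have h0 : (2 * ((m + 1 : ℕ) : ℂ)) ≠ 0 := by
    simp only [ne_eq, mul_eq_zero, OfNat.ofNat_ne_zero, false_or]
    exact_mod_cast Nat.succ_ne_zero m
  have hΓ : Gammaℝ (2 * ((m + 1 : ℕ) : ℂ)) = (Real.pi : ℂ)⁻¹ ^ (m + 1) * m.factorial := by
    rw [Gammaℝ_def, show 2 * ((m + 1 : ℕ) : ℂ) / 2 = (m : ℂ) + 1 by push_cast; ring,
      Gamma_nat_eq_factorial, show -(2 * ((m + 1 : ℕ) : ℂ)) / 2 = -((m + 1 : ℕ) : ℂ) by ring,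
      cpow_neg, cpow_natCast, inv_pow]
  have hΓ0 : Gammaℝ (2 * ((m + 1 : ℕ) : ℂ)) ≠ 0 := by
    rw [hΓ]
    have : (Real.pi : ℂ) ≠ 0 := by exact_mod_cast Real.pi_ne_zero
    have : (m.factorial : ℂ) ≠ 0 := by exact_mod_cast m.factorial_ne_zero
    positivity
  rw [riemannZeta_def_of_ne_zero h0, add_tsub_cancel_right, ← hΓ, mul_div_cancel₀ _ hΓ0,
    completedRiemannZeta_eq]
  ring

lemma norm_completedRiemannZeta₀_two : ‖completedRiemannZeta₀ 2‖ < 1 := by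
  have h := completedRiemannZeta₀_two_mul_nat (le_refl 1)
  have hpi : (Real.pi : ℂ) ≠ 0 := by exact_mod_cast Real.pi_ne_zero
  have : completedRiemannZeta₀ 2 = ((Real.pi / 6 - 1 / 2 : ℝ) : ℂ) := by
    norm_num [riemannZeta_two] at h
    rw [h]
    push_cast
    field_simp
    ring
  rw [this, norm_real, Real.norm_eq_abs, abs_lt]
  constructor <;> linarith [Real.pi_gt_three, Real.pi_lt_four]

lemma norm_riemannZeta_two_mul_nat_le {n : ℕ} (hn : 1 ≤ n) : ‖riemannZeta (2 * n)‖ ≤ 2 := by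
  have h2 : HasSum (fun n : ℕ ↦ 1 / (n : ℝ) ^ 2) (Real.pi ^ 2 / 6) := hasSum_zeta_two
  have hk : 1 < 2 * n := by omega
  have h := zeta_nat_eq_tsum_of_gt_one hk
  push_cast at h
  rw [h]
  have hle : ∀ k : ℕ, ‖1 / (k : ℂ) ^ (2 * n)‖ ≤ 1 / (k : ℝ) ^ 2 := by
    intro k
    rw [norm_div, norm_one, norm_pow, norm_natCast]
    rcases Nat.eq_zero_or_pos k with rfl | hk
    · simp [show n ≠ 0 by omega]
    · have : (1 : ℝ) ≤ k := by exact_mod_cast hk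
      gcongr
      · omega
  refine (tsum_of_norm_bounded h2 hle).trans ?_
  nlinarith [Real.pi_lt_d2, Real.pi_pos]

lemma norm_completedRiemannZeta₀_two_mul_nat_le {n : ℕ} (hn : 1 ≤ n) :
    ‖completedRiemannZeta₀ (2 * n)‖ ≤ 4 * n.factorial := by
  rw [completedRiemannZeta₀_two_mul_nat hn]
  have hfac : (1 : ℝ) ≤ n.factorial := by exact_mod_cast n.factorial_pos
  have hfac' : ((n - 1).factorial : ℝ) ≤ n.factorial := by
    exact_mod_cast Nat.factorial_le (by omega)
  have hn' : (1 : ℝ) ≤ n := by exact_mod_cast hn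
  have hpi : (Real.pi)⁻¹ ^ n ≤ 1 :=
    pow_le_one₀ (by positivity) (inv_le_one_of_one_le₀ (by linarith [Real.pi_gt_three]))
  have e1 : ‖(Real.pi : ℂ)⁻¹ ^ n * (n - 1).factorial * riemannZeta (2 * n)‖ ≤
      1 * n.factorial * 2 := by
    rw [norm_mul, norm_mul, norm_pow, norm_inv, norm_real, Real.norm_of_nonneg Real.pi_pos.le,
      norm_natCast]
    gcongr
    exact norm_riemannZeta_two_mul_nat_le hn
  have e2 : ‖(1 : ℂ) / (2 * n)‖ ≤ 1 := by
    rw [norm_div, norm_one, norm_mul, norm_natCast]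
    simp only [norm_ofNat]
    rw [div_le_one (by positivity)]
    linarith
  have e3 : ‖(1 : ℂ) / (1 - 2 * n)‖ ≤ 1 := by
    have : (1 : ℂ) - 2 * n = ((1 - 2 * n : ℝ) : ℂ) := by push_cast; ring
    rw [norm_div, norm_one, this, norm_real, Real.norm_eq_abs, abs_of_neg (by linarith),
      div_le_one (by linarith)]
    linarith
  calc _ ≤ _ + _ + _ := norm_add₃_le
    _ ≤ 4 * n.factorial := by linarith

lemma exists_differentiable_eq_mul {f p : ℂ → ℂ} (hf : Differentiable ℂ f)
    (hp : Differentiable ℂ p) (hp' : ∀ z, analyticOrderAt p z ≠ ⊤)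
    (h : ∀ z, analyticOrderAt p z ≤ analyticOrderAt f z) :
    ∃ G : ℂ → ℂ, Differentiable ℂ G ∧ ∀ z, f z = p z * G z := by
  have hm : MeromorphicOn (f / p) Set.univ := fun z _ =>
    (hf.analyticAt z).meromorphicAt.div (hp.analyticAt z).meromorphicAt
  have hG : Differentiable ℂ (toMeromorphicNFOn (f / p) Set.univ) := fun z => by
    refine (((meromorphicNFOn_toMeromorphicNFOn (f / p) Set.univ)
      (Set.mem_univ z)).meromorphicOrderAt_nonneg_iff_analyticAt.1 ?_).differentiableAt
    rw [meromorphicOrderAt_toMeromorphicNFOn hm (Set.mem_univ z),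
      meromorphicOrderAt_div (hf.analyticAt z).meromorphicAt (hp.analyticAt z).meromorphicAt,
      (hf.analyticAt z).meromorphicOrderAt_eq, (hp.analyticAt z).meromorphicOrderAt_eq]
    have h1 := h z
    have h2 := hp' z
    generalize analyticOrderAt p z = a at *
    generalize analyticOrderAt f z = b at *
    lift a to ℕ using h2
    cases b with
    | top => exact le_top
    | coe b =>
      have h3 : a ≤ b := by exact_mod_cast h1
      have : (0 : WithTop ℤ) ≤ ((b - a : ℤ) : WithTop ℤ) := by
        norm_cast
        omega
      simpa using! this
  refine ⟨_, hG, fun z => ?_⟩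
  have h1 : ∀ᶠ w in 𝓝[≠] z, f w = p w * toMeromorphicNFOn (f / p) Set.univ w := by
    have h2 : ∀ᶠ w in 𝓝[≠] z, p w ≠ 0 := by
      rcases (hp.analyticAt z).eventually_eq_zero_or_eventually_ne_zero with h3 | h3
      · exact absurd (analyticOrderAt_eq_top.2 h3) (hp' z)
      · exact h3
    filter_upwards [hm.toMeromorphicNFOn_eq_self_on_nhdsNE (Set.mem_univ z), h2] with w hw hw2
    rw [hw, Pi.div_apply]
    field_simp
  have h2 := eventuallyEq_nhds_of_eventuallyEq_nhdsNE (f := f)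
    (g := fun w => p w * toMeromorphicNFOn (f / p) Set.univ w) h1
  have h3 : f =ᶠ[𝓝[≠] z] fun w => p w * toMeromorphicNFOn (f / p) Set.univ w := h1
  have c1 : Tendsto f (𝓝[≠] z) (𝓝 (f z)) := hf.continuous.continuousAt.mono_left nhdsWithin_le_nhds
  have c2 : Tendsto (fun w => p w * toMeromorphicNFOn (f / p) Set.univ w) (𝓝[≠] z)
      (𝓝 (p z * toMeromorphicNFOn (f / p) Set.univ z)) :=
    ((hp.mul hG).continuous.continuousAt (x := z)).mono_left nhdsWithin_le_nhds
  exact tendsto_nhds_unique (c1.congr' h3) c2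

/-- The finite partial product of the factors with zeros `± i γ ν`, normalised to be `1` at
`1 / 2`. -/
noncomputable def evenProd (γ : ℕ → ℝ) (T : Finset ℕ) (w : ℂ) : ℂ :=
  ∏ ν ∈ T, ((γ ν : ℂ) ^ 2 + w ^ 2) / ((γ ν : ℂ) ^ 2 + 1 / 4)

lemma sq_add_quarter_ne_zero (g : ℝ) : (g : ℂ) ^ 2 + 1 / 4 ≠ 0 := by
  have : (g : ℂ) ^ 2 + 1 / 4 = ((g ^ 2 + 1 / 4 : ℝ) : ℂ) := by push_cast; ring
  rw [this]
  exact_mod_cast (by positivity : g ^ 2 + 1 / 4 ≠ 0)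

lemma evenProd_half (γ : ℕ → ℝ) (T : Finset ℕ) : evenProd γ T (1 / 2) = 1 := by
  refine Finset.prod_eq_one fun ν _ => ?_
  rw [show (1 / 2 : ℂ) ^ 2 = 1 / 4 by norm_num, div_self (sq_add_quarter_ne_zero _)]

lemma differentiable_evenProd (γ : ℕ → ℝ) (T : Finset ℕ) : Differentiable ℂ (evenProd γ T) := by
  unfold evenProd
  fun_prop

lemma evenProd_neg (γ : ℕ → ℝ) (T : Finset ℕ) (w : ℂ) : evenProd γ T (-w) = evenProd γ T w := by
  simp [evenProd]

lemma analyticOrderAt_factor {g : ℝ} (hg : 0 < g) (z : ℂ) :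
    analyticOrderAt (fun w : ℂ => ((g : ℂ) ^ 2 + w ^ 2) / ((g : ℂ) ^ 2 + 1 / 4)) z =
      if (g : ℂ) ^ 2 + z ^ 2 = 0 then 1 else 0 := by
  have hd : Differentiable ℂ (fun w : ℂ => ((g : ℂ) ^ 2 + w ^ 2) / ((g : ℂ) ^ 2 + 1 / 4)) := by
    fun_prop
  split_ifs with h
  · refine (hd.analyticAt z).analyticOrderAt_eq_one_of_zero_deriv_ne_zero (by simp [h]) ?_
    have hz : z ≠ 0 := by
      rintro rfl
      simp [hg.ne'] at h
    simp [deriv_div_const, hz]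
    exact_mod_cast (by simpa using sq_add_quarter_ne_zero g)
  · rw [(hd.analyticAt z).analyticOrderAt_eq_zero]
    exact div_ne_zero h (sq_add_quarter_ne_zero g)

lemma analyticOrderAt_evenProd {γ : ℕ → ℝ} (hγ : ∀ ν, 0 < γ ν) (T : Finset ℕ) (z : ℂ) :
    analyticOrderAt (evenProd γ T) z =
      (({ν | ν ∈ T ∧ (γ ν : ℂ) ^ 2 + z ^ 2 = 0} : Set ℕ).encard) := by
  classical
  have : ({ν | ν ∈ T ∧ (γ ν : ℂ) ^ 2 + z ^ 2 = 0} : Set ℕ) =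
      ((T.filter fun ν => (γ ν : ℂ) ^ 2 + z ^ 2 = 0 : Finset ℕ) : Set ℕ) := by ext; simp
  rw [this, Set.encard_coe_eq_coe_finsetCard]
  clear this
  induction T using Finset.induction_on with
  | empty =>
    simp only [Finset.filter_empty, Finset.card_empty, Nat.cast_zero]
    rw [((differentiable_evenProd γ ∅).analyticAt z).analyticOrderAt_eq_zero]
    simp [evenProd]
  | insert a T ha ih =>
    have h1 : evenProd γ (insert a T) =
        (fun w : ℂ => ((γ a : ℂ) ^ 2 + w ^ 2) / ((γ a : ℂ) ^ 2 + 1 / 4)) * evenProd γ T := by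
      ext w
      simp [evenProd, Finset.prod_insert ha]
    have hd : Differentiable ℂ
        (fun w : ℂ => ((γ a : ℂ) ^ 2 + w ^ 2) / ((γ a : ℂ) ^ 2 + 1 / 4)) := by fun_prop
    rw [h1, analyticOrderAt_mul (hd.analyticAt z) ((differentiable_evenProd γ T).analyticAt z), ih,
      analyticOrderAt_factor (hγ a), Finset.filter_insert]
    split_ifs with h
    · rw [Finset.card_insert_of_notMem (by simp [ha])]
      push_cast
      ring
    · simp

lemma exists_eq_evenProd_mul {f : ℂ → ℂ} (hf : Differentiable ℂ f) {γ : ℕ → ℝ}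
    (hγ : ∀ ν, 0 < γ ν)
    (h : ∀ z : ℂ, {ν | (γ ν : ℂ) ^ 2 + z ^ 2 = 0}.encard ≤ analyticOrderAt f z) (T : Finset ℕ) :
    ∃ G : ℂ → ℂ, Differentiable ℂ G ∧ ∀ z, f z = evenProd γ T z * G z := by
  refine exists_differentiable_eq_mul hf (differentiable_evenProd γ T) (fun z => ?_) fun z => ?_
  · rw [analyticOrderAt_evenProd hγ, Set.encard_ne_top_iff]
    exact T.finite_toSet.subset fun ν hν => hν.1
  · rw [analyticOrderAt_evenProd hγ]
    exact (Set.encard_le_encard fun ν hν => hν.2).trans (h z)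

lemma four_le_norm_factor {g R : ℝ} (hg : 0 < g) (hgR : g ≤ R) (hR : 1 ≤ R) {w : ℂ}
    (hw : ‖w‖ = 3 * R) : 4 ≤ ‖((g : ℂ) ^ 2 + w ^ 2) / ((g : ℂ) ^ 2 + 1 / 4)‖ := by
  have h1 : ‖(g : ℂ) ^ 2 + 1 / 4‖ = g ^ 2 + 1 / 4 := by
    have : (g : ℂ) ^ 2 + 1 / 4 = ((g ^ 2 + 1 / 4 : ℝ) : ℂ) := by push_cast; ring
    rw [this, Complex.norm_of_nonneg (by positivity)]
  have h2 : ‖w ^ 2‖ - ‖(g : ℂ) ^ 2‖ ≤ ‖(g : ℂ) ^ 2 + w ^ 2‖ := by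
    have h3 := norm_sub_norm_le (w ^ 2) (-((g : ℂ) ^ 2))
    rw [norm_neg] at h3
    rwa [sub_neg_eq_add, add_comm (w ^ 2)] at h3
  rw [norm_div, h1, le_div_iff₀ (by positivity)]
  rw [norm_pow, norm_pow, hw, Complex.norm_of_nonneg hg.le] at h2
  nlinarith

lemma four_pow_card_mul_norm_le {f G : ℂ → ℂ} (hG : Differentiable ℂ G) {γ : ℕ → ℝ}
    (hγ : ∀ ν, 0 < γ ν) {T : Finset ℕ} (hfG : ∀ z, f z = evenProd γ T z * G z)
    {R M : ℝ} (hR : 1 ≤ R) (hT : ∀ ν ∈ T, γ ν ≤ R) (hM : ∀ w : ℂ, ‖w‖ ≤ 3 * R → ‖f w‖ ≤ M)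
    {z : ℂ} (hz : ‖z‖ ≤ 3 * R) : 4 ^ T.card * ‖G z‖ ≤ M := by
  have hR0 : (3 * R) ≠ 0 := by positivity
  have key : ‖G z‖ ≤ M / 4 ^ T.card := by
    refine Complex.norm_le_of_forall_mem_frontier_norm_le (U := Metric.ball 0 (3 * R))
      Metric.isBounded_ball hG.diffContOnCl (fun w hw => ?_) ?_
    · rw [frontier_ball _ hR0, mem_sphere_zero_iff_norm] at hw
      have h1 : (4 : ℝ) ^ T.card ≤ ‖evenProd γ T w‖ := by
        rw [evenProd, norm_prod, ← Finset.prod_const]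
        exact Finset.prod_le_prod (fun _ _ => by norm_num)
          fun ν hν => four_le_norm_factor (hγ ν) (hT ν hν) hR hw
      have h2 := hM w hw.le
      rw [hfG, norm_mul] at h2
      rw [le_div_iff₀ (by positivity), mul_comm]
      exact (mul_le_mul_of_nonneg_right h1 (norm_nonneg _)).trans h2
    · rw [closure_ball _ hR0]
      simpa using hz
  rw [le_div_iff₀ (by positivity)] at key
  linarith

lemma card_le_of_growth {f : ℂ → ℂ} (hf : Differentiable ℂ f) (hf2 : f (1 / 2) = 1 / 2)
    {γ : ℕ → ℝ} (hγ : ∀ ν, 0 < γ ν)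
    (h : ∀ z : ℂ, {ν | (γ ν : ℂ) ^ 2 + z ^ 2 = 0}.encard ≤ analyticOrderAt f z)
    {C : ℝ} (hC : 0 ≤ C)
    (hgrow : ∀ R : ℝ, 1 ≤ R → ∀ w : ℂ, ‖w‖ ≤ R → ‖f w‖ ≤ Real.exp (C * (R * √R)))
    {T : Finset ℕ} {R : ℝ} (hR : 1 ≤ R) (hT : ∀ ν ∈ T, γ ν ≤ R) :
    (T.card : ℝ) ≤ (1 + 6 * C) * (R * √R) := by
  obtain ⟨G, hG, hfG⟩ := exists_eq_evenProd_mul hf hγ h T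
  have hG2 : G (1 / 2) = 1 / 2 := by
    have := hfG (1 / 2)
    rwa [evenProd_half, one_mul, hf2, eq_comm] at this
  have h1 := four_pow_card_mul_norm_le hG hγ hfG hR hT (hgrow (3 * R) (by linarith))
    (z := 1 / 2) (by norm_num; linarith)
  rw [hG2] at h1
  have hs : 1 ≤ √R := Real.one_le_sqrt.2 hR
  have hs3 : √(3 * R) ≤ 2 * √R := by
    rw [Real.sqrt_mul (by norm_num)]
    gcongr
    rw [Real.sqrt_le_left (by norm_num)]
    norm_num
  have h2 : (4 : ℝ) ^ T.card ≤ Real.exp (1 + 6 * C * (R * √R)) := by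
    have e1 : (2 : ℝ) ≤ Real.exp 1 := by
      have := Real.add_one_le_exp (1 : ℝ)
      linarith
    have e2 : Real.exp (C * (3 * R * √(3 * R))) ≤ Real.exp (6 * C * (R * √R)) := by
      apply Real.exp_le_exp.2
      calc C * (3 * R * √(3 * R)) ≤ C * (3 * R * (2 * √R)) := by gcongr
        _ = _ := by ring
    rw [Real.exp_add]
    rw [show ‖(1 / 2 : ℂ)‖ = 1 / 2 by norm_num] at h1
    have := Real.exp_pos (6 * C * (R * √R))
    nlinarith
  have h3 : Real.exp T.card ≤ 4 ^ T.card := by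
    rw [← Real.exp_one_pow]
    have := Real.exp_one_lt_d9
    gcongr
    linarith
  have h4 := Real.exp_le_exp.1 (h3.trans h2)
  nlinarith

lemma summable_of_card_le {γ : ℕ → ℝ} (hγ : ∀ ν, 0 < γ ν) {A : ℝ} (hA : 0 ≤ A)
    (h : ∀ (T : Finset ℕ) (R : ℝ), 1 ≤ R → (∀ ν ∈ T, γ ν ≤ R) → (T.card : ℝ) ≤ A * (R * √R)) :
    Summable fun ν => 1 / (γ ν ^ 2 + 1 / 4) := by
  set k : ℕ → ℕ := fun ν => Nat.log 4 ⌊γ ν⌋₊ with hk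
  have hk1 : ∀ ν, γ ν ≤ 4 ^ (k ν + 1) := fun ν => by
    have h1 : ⌊γ ν⌋₊ + 1 ≤ 4 ^ (k ν + 1) := Nat.lt_pow_succ_log_self (by norm_num) _
    have h2 : ((⌊γ ν⌋₊ + 1 : ℕ) : ℝ) ≤ 4 ^ (k ν + 1) := by exact_mod_cast h1
    push_cast at h2
    exact (Nat.lt_floor_add_one _).le.trans h2
  have hk2 : ∀ ν, 1 / (γ ν ^ 2 + 1 / 4) ≤ 4 * (1 / 16) ^ k ν := fun ν => by
    have h0 : (0 : ℝ) < 16 ^ k ν := by positivity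
    rw [one_div_pow, mul_one_div, div_le_div_iff₀ (by have := hγ ν; positivity) h0]
    rcases Nat.eq_zero_or_pos ⌊γ ν⌋₊ with h1 | h1
    · have : k ν = 0 := by simp [hk, h1]
      rw [this]
      nlinarith [sq_nonneg (γ ν)]
    · have h2 : ((4 ^ k ν : ℕ) : ℝ) ≤ ⌊γ ν⌋₊ :=
        Nat.cast_le.2 (Nat.pow_log_le_self 4 h1.ne')
      have h3 : (4 : ℝ) ^ k ν ≤ γ ν := by
        push_cast at h2
        exact h2.trans (Nat.floor_le (hγ ν).le)
      have h4 : (16 : ℝ) ^ k ν = (4 ^ k ν) ^ 2 := by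
        rw [← pow_mul, mul_comm, pow_mul]; norm_num
      have h5 : (0 : ℝ) < 4 ^ k ν := by positivity
      rw [h4]
      nlinarith
  refine summable_of_sum_le (c := 64 * A) (fun ν => by have := hγ ν; positivity) fun T => ?_
  classical
  rw [← Finset.sum_fiberwise_of_maps_to (t := T.image k) (g := k)
    (fun ν hν => Finset.mem_image_of_mem _ hν)]
  have hj : ∀ j ∈ T.image k, ∑ ν ∈ T with k ν = j, 1 / (γ ν ^ 2 + 1 / 4) ≤
      32 * A * (1 / 2) ^ j := fun j _ => by
    have hc := h (T.filter fun ν => k ν = j) (4 ^ (j + 1)) (one_le_pow₀ (by norm_num))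
      (fun ν hν => by
        have := hk1 ν
        rwa [(Finset.mem_filter.1 hν).2] at this)
    have hs : √((4 : ℝ) ^ (j + 1)) = 2 ^ (j + 1) := by
      rw [show (4 : ℝ) = 2 ^ 2 by norm_num, ← pow_mul, mul_comm, pow_mul,
        Real.sqrt_sq (by positivity)]
    rw [hs] at hc
    calc ∑ ν ∈ T with k ν = j, 1 / (γ ν ^ 2 + 1 / 4)
        ≤ ∑ ν ∈ T with k ν = j, 4 * (1 / 16 : ℝ) ^ j :=
          Finset.sum_le_sum fun ν hν => by
            have := hk2 ν
            rwa [(Finset.mem_filter.1 hν).2] at this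
      _ = (T.filter fun ν => k ν = j).card * (4 * (1 / 16 : ℝ) ^ j) := by
          rw [Finset.sum_const, nsmul_eq_mul]
      _ ≤ A * (4 ^ (j + 1) * 2 ^ (j + 1)) * (4 * (1 / 16 : ℝ) ^ j) := by gcongr
      _ = 32 * A * (4 * 2 * (1 / 16) : ℝ) ^ j := by
          rw [mul_pow, mul_pow]; ring
      _ = _ := by norm_num
  calc _ ≤ ∑ j ∈ T.image k, 32 * A * (1 / 2) ^ j := Finset.sum_le_sum hj
    _ = 32 * A * ∑ j ∈ T.image k, (1 / 2 : ℝ) ^ j := by rw [Finset.mul_sum]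
    _ ≤ 32 * A * 2 := by
        gcongr
        exact sum_le_hasSum _ (fun _ _ => by positivity) hasSum_geometric_two
    _ = 64 * A := by ring

lemma finite_of_card_le {γ : ℕ → ℝ} {A : ℝ}
    (h : ∀ (T : Finset ℕ) (R : ℝ), 1 ≤ R → (∀ ν ∈ T, γ ν ≤ R) → (T.card : ℝ) ≤ A * (R * √R))
    (n : ℕ) : {ν | γ ν ≤ n}.Finite := by
  by_contra hinf
  obtain ⟨T, hT, hc⟩ := Set.Infinite.exists_subset_card_eq hinf
    (⌊A * ((n + 1 : ℝ) * √(n + 1))⌋₊ + 1)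
  have h1 := h T (n + 1) (by have := n.cast_nonneg (α := ℝ); linarith)
    fun ν hν => (show γ ν ≤ n from hT hν).trans (by linarith)
  rw [hc] at h1
  have h2 := Nat.lt_floor_add_one (A * ((n + 1 : ℝ) * √(n + 1)))
  push_cast at h1
  linarith

lemma exists_log_small {G : ℂ → ℂ} (hG : Differentiable ℂ G) {R B : ℝ} (hR : 0 < R) (hB : 0 < B)
    (hnz : ∀ z, ‖z‖ < R → G z ≠ 0) (hM : ∀ z, ‖z‖ < R → ‖G z‖ ≤ ‖G 0‖ * Real.exp B)
    (hd : deriv G 0 = 0) :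
    ∃ L : ℂ → ℂ, (∀ z, ‖z‖ < R → G z = G 0 * exp (L z)) ∧
      ∀ z, ‖z‖ < R / 2 → ‖L z‖ ≤ 2 * B * (‖z‖ / (R / 2)) ^ 2 := by
  have hmem : ∀ z : ℂ, z ∈ Metric.ball (0 : ℂ) R ↔ ‖z‖ < R := by simp
  have h0 : G 0 ≠ 0 := hnz 0 (by simpa)
  have hq : DifferentiableOn ℂ (fun z => deriv G z / G z) (Metric.ball 0 R) := by
    refine DifferentiableOn.div (hG.deriv).differentiableOn hG.differentiableOn ?_
    exact fun z hz => hnz z ((hmem z).1 hz)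
  obtain ⟨L, hL0, hL⟩ := hq.isExactOn_ball.with_val_at 0 0
  have hexp : ∀ z, ‖z‖ < R → G z = G 0 * exp (L z) := by
    have hder : ∀ z ∈ Metric.ball (0 : ℂ) R,
        HasDerivAt (fun z => G z * exp (-L z)) 0 z := fun z hz => by
      have h1 := (hG z).hasDerivAt.mul (hL z hz).neg.cexp
      refine h1.congr_deriv ?_
      rw [mul_neg, mul_neg, mul_left_comm, mul_div_cancel₀ _ (hnz z ((hmem z).1 hz)), mul_comm,
        add_neg_cancel]
    intro z hz
    have h1 := (convex_ball (0 : ℂ) R).is_const_of_fderivWithin_eq_zero (𝕜 := ℂ)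
      (f := fun z => G z * exp (-L z))
      (fun z hz => (hder z hz).differentiableAt.differentiableWithinAt)
      (fun z hz => by
        rw [fderivWithin_of_isOpen Metric.isOpen_ball hz]
        ext
        simp [(hder z hz).deriv])
      ((hmem z).2 hz) ((hmem 0).2 (by simpa))
    simp only [hL0, neg_zero, exp_zero, mul_one] at h1
    rw [← h1, mul_assoc, ← exp_add]
    simp
  refine ⟨L, hexp, fun z hz => ?_⟩
  have hLd : DifferentiableOn ℂ L (Metric.ball 0 R) :=
    fun z hz => (hL z hz).differentiableAt.differentiableWithinAt
  have hre : Set.MapsTo L (Metric.ball 0 R) {z | z.re ≤ B} := fun w hw => by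
    have h1 := hM w ((hmem w).1 hw)
    rw [hexp w ((hmem w).1 hw), norm_mul, Complex.norm_exp] at h1
    exact Real.exp_le_exp.1 (le_of_mul_le_mul_left h1 (norm_pos_iff.2 h0))
  have hbc : ∀ w, ‖w‖ < R / 2 → ‖L w‖ ≤ 2 * B := fun w hw => by
    refine (borelCaratheodory_zero hB hLd hre hR ((hmem w).2 (by linarith)) hL0).trans ?_
    rw [div_le_iff₀ (by linarith)]
    nlinarith
  have := Complex.dist_le_mul_div_pow_of_mapsTo_ball_of_isLittleO (f := L) (c := 0) (z := z)
    (R₁ := R / 2) (R₂ := 2 * B) (n := 1)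
    (hLd.mono (Metric.ball_subset_ball (by linarith)))
    (fun w hw => by simpa [hL0] using hbc w (by simpa using hw)) ?_ (by simpa using hz)
  · simpa [hL0] using this
  · have h1 := hL 0 ((hmem 0).2 (by simpa))
    rw [hd, zero_div, hasDerivAt_iff_isLittleO] at h1
    simp only [sub_zero, smul_zero] at h1
    simpa using h1.norm_right

lemma factor_eq_one_add (g : ℝ) (z : ℂ) : ((g : ℂ) ^ 2 + z ^ 2) / ((g : ℂ) ^ 2 + 1 / 4) =
    1 + (z ^ 2 - 1 / 4) * ((1 / (g ^ 2 + 1 / 4) : ℝ) : ℂ) := by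
  have := sq_add_quarter_ne_zero g
  push_cast
  rw [div_eq_iff this, add_mul, mul_assoc, one_div_mul_cancel this]
  ring

lemma summable_norm_factor {γ : ℕ → ℝ} (h : Summable fun ν => 1 / (γ ν ^ 2 + 1 / 4)) (z : ℂ) :
    Summable fun ν => ‖(z ^ 2 - 1 / 4) * ((1 / (γ ν ^ 2 + 1 / 4) : ℝ) : ℂ)‖ := by
  simp_rw [norm_mul]
  refine Summable.mul_left _ (h.congr fun ν => ?_)
  rw [Complex.norm_of_nonneg (by positivity)]

lemma norm_evenProd_zero_le (γ : ℕ → ℝ) (T : Finset ℕ) : ‖evenProd γ T 0‖ ≤ 1 := by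
  rw [evenProd, norm_prod]
  refine Finset.prod_le_one (fun _ _ => norm_nonneg _) fun ν _ => ?_
  have : ((γ ν : ℂ) ^ 2 + 0 ^ 2) / ((γ ν : ℂ) ^ 2 + 1 / 4) =
      ((γ ν ^ 2 / (γ ν ^ 2 + 1 / 4) : ℝ) : ℂ) := by push_cast; simp
  rw [this, Complex.norm_of_nonneg (by positivity)]
  exact div_le_one_of_le₀ (by linarith) (by positivity)

lemma deriv_zero_of_even {f : ℂ → ℂ} (h : ∀ w, f (-w) = f w) : deriv f 0 = 0 := by
  have h1 : deriv (fun w => f (-w)) 0 = -deriv f (-0) := deriv_comp_neg f 0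
  have h2 : (fun w => f (-w)) = f := funext h
  rw [h2, neg_zero] at h1
  exact self_eq_neg.1 h1

lemma exists_quotient_log {f : ℂ → ℂ} (hf : Differentiable ℂ f) (heven : ∀ w, f (-w) = f w)
    (hf0 : f 0 ≠ 0) {γ : ℕ → ℝ} (hγ : ∀ ν, 0 < γ ν)
    (h : ∀ z : ℂ, {ν | (γ ν : ℂ) ^ 2 + z ^ 2 = 0}.encard = analyticOrderAt f z)
    {C : ℝ} (hC : 0 ≤ C)
    (hgrow : ∀ R : ℝ, 1 ≤ R → ∀ w : ℂ, ‖w‖ ≤ R → ‖f w‖ ≤ Real.exp (C * (R * √R)))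
    {T : Finset ℕ} {R : ℝ} (hR : 1 ≤ R) (hT : ∀ ν, ν ∈ T ↔ γ ν ≤ R) :
    ∃ G L : ℂ → ℂ, (∀ z, f z = evenProd γ T z * G z) ∧
      (∀ z, ‖z‖ < R → G z = G 0 * exp (L z)) ∧ G 0 ≠ 0 ∧
      ∀ z, ‖z‖ < R / 2 → ‖L z‖ ≤
        2 * (6 * C * (R * √R) + |Real.log ‖f 0‖| + 1) * (‖z‖ / (R / 2)) ^ 2 := by
  obtain ⟨G, hG, hfG⟩ := exists_eq_evenProd_mul hf hγ (fun z => (h z).le) T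
  have hP := differentiable_evenProd γ T
  have hR0 : 0 < R := by linarith
  have hfac : f = evenProd γ T * G := funext hfG
  have hnz : ∀ z, ‖z‖ < R → G z ≠ 0 := fun z hz => by
    have h1 : analyticOrderAt f z = analyticOrderAt (evenProd γ T) z + analyticOrderAt G z := by
      rw [hfac, analyticOrderAt_mul (hP.analyticAt z) (hG.analyticAt z)]
    have h2 : analyticOrderAt (evenProd γ T) z = analyticOrderAt f z := by
      rw [analyticOrderAt_evenProd hγ, ← h z]
      congr 1
      ext ν
      simp only [Set.mem_ofPred_eq, and_iff_right_iff_imp]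
      intro hν
      have h3 : ‖(γ ν : ℂ)‖ ^ 2 = ‖z‖ ^ 2 := by
        rw [← norm_pow, ← norm_pow, eq_neg_of_add_eq_zero_left hν, norm_neg]
      rw [Complex.norm_of_nonneg (hγ ν).le] at h3
      have h4 : γ ν = ‖z‖ := (sq_eq_sq₀ (hγ ν).le (norm_nonneg _)).1 h3
      rw [hT, h4]
      exact hz.le
    have h3 : analyticOrderAt (evenProd γ T) z ≠ ⊤ := by
      rw [analyticOrderAt_evenProd hγ, Set.encard_ne_top_iff]
      exact T.finite_toSet.subset fun ν hν => hν.1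
    rw [← (hG.analyticAt z).analyticOrderAt_eq_zero]
    rw [← h2] at h1
    generalize analyticOrderAt (evenProd γ T) z = a at *
    generalize analyticOrderAt G z = b at *
    lift a to ℕ using h3
    cases b with
    | top => simp at h1
    | coe b =>
      have : a = a + b := by exact_mod_cast h1
      have : b = 0 := by omega
      simp [this]
  have hG0 : G 0 ≠ 0 := hnz 0 (by simpa)
  have hP0 : evenProd γ T 0 ≠ 0 := fun h0 => hf0 (by rw [hfG, h0, zero_mul])
  have hd : deriv G 0 = 0 := by
    have h1 : deriv f 0 = deriv (evenProd γ T) 0 * G 0 + evenProd γ T 0 * deriv G 0 := by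
      rw [hfac, deriv_mul (hP 0) (hG 0)]
    rw [deriv_zero_of_even heven, deriv_zero_of_even (evenProd_neg γ T), zero_mul, zero_add] at h1
    exact (mul_eq_zero.1 h1.symm).resolve_left hP0
  have hs3 : √(3 * R) ≤ 2 * √R := by
    rw [Real.sqrt_mul (by norm_num)]
    gcongr
    rw [Real.sqrt_le_left (by norm_num)]
    norm_num
  have hfG0 : ‖f 0‖ ≤ ‖G 0‖ := by
    rw [hfG, norm_mul]
    exact mul_le_of_le_one_left (norm_nonneg _) (norm_evenProd_zero_le γ T)
  have hf0' : 0 < ‖f 0‖ := norm_pos_iff.2 hf0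
  obtain ⟨L, hL1, hL2⟩ := exists_log_small hG hR0
    (B := 6 * C * (R * √R) + |Real.log ‖f 0‖| + 1) (by positivity) hnz (fun z hz => by
      have h1 := four_pow_card_mul_norm_le hG hγ hfG hR (fun ν hν => (hT ν).1 hν)
        (hgrow (3 * R) (by linarith)) (z := z) (by linarith)
      have h2 : ‖G z‖ ≤ 4 ^ T.card * ‖G z‖ :=
        le_mul_of_one_le_left (norm_nonneg _) (one_le_pow₀ (by norm_num))
      refine (h2.trans h1).trans ?_
      calc Real.exp (C * (3 * R * √(3 * R))) ≤
            Real.exp (Real.log ‖f 0‖ + (6 * C * (R * √R) + |Real.log ‖f 0‖| + 1)) := by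
            apply Real.exp_le_exp.2
            have h3 : C * (3 * R * √(3 * R)) ≤ C * (3 * R * (2 * √R)) := by gcongr
            have := neg_abs_le (Real.log ‖f 0‖)
            linarith
        _ = ‖f 0‖ * Real.exp (6 * C * (R * √R) + |Real.log ‖f 0‖| + 1) := by
            rw [Real.exp_add, Real.exp_log hf0']
        _ ≤ _ := by gcongr) hd
  exact ⟨G, L, hfG, hL1, hG0, hL2⟩

lemma tendsto_log_bound (a b c : ℝ) : Tendsto
    (fun n : ℕ => 2 * (a * ((n : ℝ) * √n) + b) * (c / ((n : ℝ) / 2)) ^ 2) atTop (𝓝 0) := by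
  have h1 : Tendsto (fun n : ℕ => (√(n : ℝ))⁻¹) atTop (𝓝 0) :=
    tendsto_inv_atTop_zero.comp (Real.tendsto_sqrt_atTop.comp tendsto_natCast_atTop_atTop)
  have h2 : Tendsto (fun n : ℕ => 8 * c ^ 2 * (a * (√(n : ℝ))⁻¹ + b * (√(n : ℝ))⁻¹ ^ 4))
      atTop (𝓝 (8 * c ^ 2 * (a * 0 + b * 0 ^ 4))) :=
    ((h1.const_mul a).add ((h1.pow 4).const_mul b)).const_mul _
  rw [show 8 * c ^ 2 * (a * 0 + b * 0 ^ 4) = 0 by ring] at h2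
  refine h2.congr' ?_
  filter_upwards [eventually_gt_atTop 0] with n hn
  have hs : 0 < √(n : ℝ) := Real.sqrt_pos.2 (by exact_mod_cast hn)
  have hn' : (n : ℝ) = √(n : ℝ) ^ 2 := (Real.sq_sqrt n.cast_nonneg).symm
  set s := √(n : ℝ)
  rw [hn']
  field_simp
  ring

theorem eq_half_mul_tprod_of_even {f : ℂ → ℂ} (hf : Differentiable ℂ f)
    (heven : ∀ w, f (-w) = f w) (hf2 : f (1 / 2) = 1 / 2) (hf0 : f 0 ≠ 0) {γ : ℕ → ℝ}
    (hγ : ∀ ν, 0 < γ ν)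
    (h : ∀ z : ℂ, {ν | (γ ν : ℂ) ^ 2 + z ^ 2 = 0}.encard = analyticOrderAt f z)
    {C : ℝ} (hC : 0 ≤ C)
    (hgrow : ∀ R : ℝ, 1 ≤ R → ∀ w : ℂ, ‖w‖ ≤ R → ‖f w‖ ≤ Real.exp (C * (R * √R))) (z : ℂ) :
    f z = 1 / 2 * ∏' ν, ((γ ν : ℂ) ^ 2 + z ^ 2) / ((γ ν : ℂ) ^ 2 + 1 / 4) := by
  have hcard : ∀ (T : Finset ℕ) (R : ℝ), 1 ≤ R → (∀ ν ∈ T, γ ν ≤ R) →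
      (T.card : ℝ) ≤ (1 + 6 * C) * (R * √R) :=
    fun T R hR hT => card_le_of_growth hf hf2 hγ (fun z => (h z).le) hC hgrow hR hT
  have hsum := summable_of_card_le hγ (by positivity) hcard
  have hfin := finite_of_card_le hcard
  set T : ℕ → Finset ℕ := fun n => (hfin n).toFinset with hTdef
  have hT : ∀ n ν, ν ∈ T n ↔ γ ν ≤ n := fun n ν => by simp [hTdef]
  have hTtop : Tendsto T atTop atTop := by
    refine tendsto_atTop_finset_of_monotone (fun m n hmn ν hν => ?_) fun ν => ?_
    · rw [hT] at hν ⊢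
      exact hν.trans (by exact_mod_cast hmn)
    · exact ⟨⌈γ ν⌉₊, (hT _ _).2 (Nat.le_ceil _)⟩
  have hprod : Tendsto (fun n => evenProd γ (T n) z) atTop
      (𝓝 (∏' ν, ((γ ν : ℂ) ^ 2 + z ^ 2) / ((γ ν : ℂ) ^ 2 + 1 / 4))) := by
    have hm : Multipliable fun ν => ((γ ν : ℂ) ^ 2 + z ^ 2) / ((γ ν : ℂ) ^ 2 + 1 / 4) := by
      simp_rw [factor_eq_one_add]
      exact multipliable_one_add_of_summable (summable_norm_factor hsum z)
    exact hm.hasProd.comp hTtop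
  have hex : ∀ n : ℕ, ∃ G L : ℂ → ℂ, 1 ≤ n → (∀ z, f z = evenProd γ (T n) z * G z) ∧
      (∀ z, ‖z‖ < (n : ℝ) → G z = G 0 * exp (L z)) ∧ G 0 ≠ 0 ∧
      ∀ z, ‖z‖ < (n : ℝ) / 2 → ‖L z‖ ≤
        2 * (6 * C * (n * √n) + |Real.log ‖f 0‖| + 1) * (‖z‖ / (n / 2)) ^ 2 := fun n => by
    by_cases hn : 1 ≤ n
    · obtain ⟨G, L, hGL⟩ := exists_quotient_log hf heven hf0 hγ h hC hgrow
        (T := T n) (R := n) (by exact_mod_cast hn) (hT n)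
      exact ⟨G, L, fun _ => hGL⟩
    · exact ⟨0, 0, fun h => absurd h hn⟩
  choose G L hGL using hex
  have hlim : ∀ w : ℂ, Tendsto (fun n => L n w) atTop (𝓝 0) := fun w => by
    refine squeeze_zero_norm' ?_
      (tendsto_log_bound (6 * C) (|Real.log ‖f 0‖| + 1) ‖w‖)
    filter_upwards [eventually_gt_atTop (⌈2 * ‖w‖⌉₊), eventually_ge_atTop 1] with n hn hn1
    have := Nat.lt_of_ceil_lt hn
    refine ((hGL n hn1).2.2.2 w (by linarith)).trans (le_of_eq ?_)
    ring
  have hlimexp : Tendsto (fun n => evenProd γ (T n) z * (1 / 2 * exp (L n z - L n (1 / 2)))) atTop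
      (𝓝 ((∏' ν, ((γ ν : ℂ) ^ 2 + z ^ 2) / ((γ ν : ℂ) ^ 2 + 1 / 4)) *
        (1 / 2 * exp (0 - 0)))) :=
    hprod.mul ((((hlim z).sub (hlim (1 / 2))).cexp).const_mul _)
  have hconst : (fun n => evenProd γ (T n) z * (1 / 2 * exp (L n z - L n (1 / 2)))) =ᶠ[atTop]
      fun _ => f z := by
    filter_upwards [eventually_gt_atTop (⌈2 * ‖z‖⌉₊), eventually_ge_atTop 1] with n hn hn1
    have hz := Nat.lt_of_ceil_lt hn
    have hn1' : (1 : ℝ) ≤ n := by exact_mod_cast hn1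
    obtain ⟨h1, h2, h3, -⟩ := hGL n hn1
    have h4 : G n (1 / 2) = 1 / 2 := by
      have := h1 (1 / 2)
      rwa [evenProd_half, one_mul, hf2, eq_comm] at this
    rw [h2 (1 / 2) (by norm_num; linarith)] at h4
    rw [h1 z, h2 z (by have := norm_nonneg z; linarith), exp_sub,
      eq_div_of_mul_eq (exp_ne_zero _) h4]
    ring
  have := tendsto_nhds_unique (tendsto_const_nhds.congr' hconst.symm) hlimexp
  rw [this, sub_zero, exp_zero]
  ring

/-- Riemann's `ξ` function, recentred so that the functional equation becomes evenness. -/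
noncomputable def centeredXi (w : ℂ) : ℂ :=
  ((w ^ 2 - 1 / 4) * completedRiemannZeta₀ (1 / 2 + w) + 1) / 2

lemma differentiable_centeredXi : Differentiable ℂ centeredXi := by
  have h := differentiable_completedZeta₀.comp
    ((differentiable_const (1 / 2 : ℂ)).add (differentiable_id (𝕜 := ℂ) (E := ℂ)))
  exact ((((differentiable_id.pow 2).sub_const (1 / 4)).mul h).add_const 1).div_const 2

lemma centeredXi_neg (w : ℂ) : centeredXi (-w) = centeredXi w := by
  have : completedRiemannZeta₀ (1 / 2 + -w) = completedRiemannZeta₀ (1 / 2 + w) := by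
    rw [← completedRiemannZeta₀_one_sub (1 / 2 + w)]
    congr 1
    ring
  rw [centeredXi, centeredXi, this, neg_sq]

lemma centeredXi_half : centeredXi (1 / 2) = 1 / 2 := by
  rw [centeredXi]
  norm_num

lemma centeredXi_zero_ne_zero : centeredXi 0 ≠ 0 := by
  intro h
  have h1 : completedRiemannZeta₀ (1 / 2) = 4 := by
    rw [centeredXi, add_zero] at h
    linear_combination (-8) * h
  have h2 := norm_completedRiemannZeta₀_le (s := 1 / 2) (a := 2) (by norm_num) (by norm_num)
  have h3 := norm_completedRiemannZeta₀_two
  rw [h1] at h2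
  norm_num at h2
  linarith

lemma centeredXi_sub_half {s : ℂ} (h0 : s ≠ 0) (h1 : s ≠ 1) :
    centeredXi (s - 1 / 2) = s / 2 * (s - 1) * completedRiemannZeta s := by
  have h2 : 1 - s ≠ 0 := sub_ne_zero.2 h1.symm
  rw [centeredXi, completedRiemannZeta_eq, add_sub_cancel]
  field_simp
  ring

lemma centeredXi_sub_half_eq_mul_zeta {s : ℂ} (h0 : s ≠ 0) (h1 : s ≠ 1) (hΓ : Gammaℝ s ≠ 0) :
    centeredXi (s - 1 / 2) = s / 2 * (s - 1) * Gammaℝ s * riemannZeta s := by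
  rw [centeredXi_sub_half h0 h1, riemannZeta_def_of_ne_zero h0]
  field_simp

lemma norm_centeredXi_le {R : ℝ} (hR : 1 ≤ R) {w : ℂ} (hw : ‖w‖ ≤ R) :
    ‖centeredXi w‖ ≤ Real.exp (26 * (R * √R)) := by
  set n := ⌈R⌉₊ with hn
  have hn1 : R ≤ n := Nat.le_ceil R
  have hn2 : (n : ℝ) ≤ 2 * R := by
    have := Nat.ceil_lt_add_one (show 0 ≤ R by linarith)
    linarith
  have hn0 : 1 ≤ n := by exact_mod_cast hR.trans hn1
  have hre := abs_le.1 ((abs_re_le_norm w).trans hw)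
  have h1 : ‖completedRiemannZeta₀ (1 / 2 + w)‖ ≤ 8 * (n : ℝ) ^ n := by
    have e1 := norm_completedRiemannZeta₀_le (s := 1 / 2 + w) (a := 2 * n)
      (by simp; linarith) (by simp; linarith)
    have e2 := norm_completedRiemannZeta₀_two_mul_nat_le hn0
    have e3 : (n.factorial : ℝ) ≤ (n : ℝ) ^ n := by exact_mod_cast n.factorial_le_pow
    push_cast at e1
    linarith
  have h2 : ‖w ^ 2 - 1 / 4‖ ≤ 5 / 4 * (n : ℝ) ^ 2 := by
    refine (norm_sub_le _ _).trans ?_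
    rw [norm_pow]
    have : ‖w‖ ^ 2 ≤ (n : ℝ) ^ 2 := by gcongr; exact hw.trans hn1
    norm_num
    nlinarith
  have hnn : (1 : ℝ) ≤ n := hR.trans hn1
  have h3 : ‖centeredXi w‖ ≤ 6 * (n : ℝ) ^ (n + 2) := by
    rw [centeredXi, norm_div]
    have e1 : ‖(w ^ 2 - 1 / 4) * completedRiemannZeta₀ (1 / 2 + w) + 1‖ ≤
        5 / 4 * (n : ℝ) ^ 2 * (8 * (n : ℝ) ^ n) + 1 := by
      refine (norm_add_le _ _).trans ?_
      rw [norm_mul, norm_one]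
      gcongr
    have e2 : (1 : ℝ) ≤ (n : ℝ) ^ (n + 2) := one_le_pow₀ hnn
    rw [show ‖(2 : ℂ)‖ = 2 by norm_num, div_le_iff₀ (by norm_num)]
    rw [pow_add] at e2 ⊢
    nlinarith
  have hlog : Real.log n ≤ 2 * √n := by
    have e1 := Real.log_le_sub_one_of_pos (show 0 < √(n : ℝ) by positivity)
    rw [Real.log_sqrt n.cast_nonneg] at e1
    linarith
  have h4 : (n : ℝ) ^ (n + 2) = Real.exp ((n + 2) * Real.log n) := by
    rw [show (n : ℝ) + 2 = ((n + 2 : ℕ) : ℝ) by push_cast; rfl, Real.exp_nat_mul,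
      Real.exp_log (by linarith)]
  have h5 : (6 : ℝ) ≤ Real.exp 2 := by
    have := Real.exp_one_gt_d9
    rw [show (2 : ℝ) = 1 + 1 by norm_num, Real.exp_add]
    nlinarith
  have hs : √(n : ℝ) ≤ 2 * √R := by
    refine (Real.sqrt_le_sqrt hn2).trans ?_
    rw [Real.sqrt_mul (by norm_num)]
    gcongr
    rw [Real.sqrt_le_left (by norm_num)]
    norm_num
  have hs1 : 1 ≤ √R := Real.one_le_sqrt.2 hR
  refine h3.trans ?_
  rw [h4]
  calc 6 * Real.exp ((n + 2) * Real.log n) ≤ Real.exp 2 * Real.exp ((n + 2) * Real.log n) := by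
        gcongr
    _ = Real.exp (2 + (n + 2) * Real.log n) := (Real.exp_add _ _).symm
    _ ≤ _ := by
      apply Real.exp_le_exp.2
      have e1 : ((n : ℝ) + 2) * Real.log n ≤ (2 * R + 2) * (2 * (2 * √R)) := by
        gcongr
        exact hlog.trans (by linarith)
      nlinarith

lemma analyticOrderAt_centeredXi_neg (z : ℂ) :
    analyticOrderAt centeredXi (-z) = analyticOrderAt centeredXi z := by
  have h := analyticOrderAt_comp_of_deriv_ne_zero (f := centeredXi) (g := fun w : ℂ => -w)
    (z₀ := z) (by fun_prop) (by simp)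
  rw [← h]
  congr 1
  exact funext centeredXi_neg

lemma Gammaℝ_half_add_ne_zero {z : ℂ} (hz : 0 ≤ z.re) : Gammaℝ (1 / 2 + z) ≠ 0 :=
  Gammaℝ_ne_zero_of_re_pos (by simp; linarith)

lemma analyticOrderAt_centeredXi_of_zeroOfOrder {z : ℂ} (hz : 0 ≤ z.re) (h1 : z ≠ 1 / 2) {m : ℕ}
    (h : ZeroOfOrder riemannZeta (1 / 2 + z) m) : analyticOrderAt centeredXi z = m := by
  obtain ⟨g, hg, hg0, hev⟩ := h
  have hs0 : 1 / 2 + z ≠ 0 := fun h => by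
    have := congrArg re h
    simp at this
    linarith
  have hs1 : 1 / 2 + z ≠ 1 := fun h => h1 (by linear_combination h)
  have hΓ := Gammaℝ_half_add_ne_zero hz
  have hadd : AnalyticAt ℂ (fun w : ℂ => 1 / 2 + w) z := by fun_prop
  have hpre : AnalyticAt ℂ (fun s : ℂ => s / 2 * (s - 1) * Gammaℝ s) (1 / 2 + z) := by
    have : AnalyticAt ℂ Gammaℝ (1 / 2 + z) := by
      have h2 := (differentiable_Gammaℝ_inv.analyticAt (1 / 2 + z)).inv (inv_ne_zero hΓ)
      simpa [Pi.inv_def] using h2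
    fun_prop
  rw [(differentiable_centeredXi.analyticAt z).analyticOrderAt_eq_natCast]
  set H : ℂ → ℂ := fun w =>
    (1 / 2 + w) / 2 * ((1 / 2 + w) - 1) * Gammaℝ (1 / 2 + w) * g (1 / 2 + w) with hH
  have hHan : AnalyticAt ℂ H z :=
    (AnalyticAt.fun_comp (g := fun s : ℂ => s / 2 * (s - 1) * Gammaℝ s) hpre hadd).mul
      (AnalyticAt.fun_comp hg hadd)
  refine ⟨H, hHan, ?_, ?_⟩
  · simp only [hH]
    refine mul_ne_zero (mul_ne_zero (mul_ne_zero (div_ne_zero hs0 two_ne_zero)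
      (sub_ne_zero.2 hs1)) hΓ) hg0
  · refine (ContinuousAt.eventuallyEq_nhds_iff_eventuallyEq_nhdsNE
      differentiable_centeredXi.continuous.continuousAt ?_).1 ?_
    · exact (((continuous_id.sub continuous_const).pow m).continuousAt).smul hHan.continuousAt
    · have htend : Tendsto (fun w : ℂ => 1 / 2 + w) (𝓝[≠] z) (𝓝[≠] (1 / 2 + z)) :=
        tendsto_nhdsWithin_of_tendsto_nhds_of_eventually_within _
          (hadd.continuousAt.tendsto.mono_left nhdsWithin_le_nhds)
          (eventually_nhdsWithin_of_forall fun w hw => by simpa using hw)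
      have hne : ∀ᶠ w in 𝓝[≠] z, 1 / 2 + w ≠ 0 ∧ 1 / 2 + w ≠ 1 ∧ (Gammaℝ (1 / 2 + w))⁻¹ ≠ 0 := by
        have c : ContinuousAt (fun w : ℂ => 1 / 2 + w) z := hadd.continuousAt
        exact ((c.eventually_ne hs0).and ((c.eventually_ne hs1).and
          (ContinuousAt.eventually_ne ((differentiable_Gammaℝ_inv.continuous.continuousAt).comp c)
            (inv_ne_zero hΓ)))).filter_mono nhdsWithin_le_nhds
      filter_upwards [htend.eventually hev, hne] with w hw ⟨hw0, hw1, hw2⟩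
      have h3 := centeredXi_sub_half_eq_mul_zeta hw0 hw1 (by simpa using hw2)
      rw [add_sub_cancel_left, hw] at h3
      rw [h3, smul_eq_mul, hH]
      ring

lemma sq_add_sq_eq_zero_iff {g : ℝ} {z : ℂ} (hz : z.re = 0) (hz' : 0 < z.im) (hg : 0 < g) :
    (g : ℂ) ^ 2 + z ^ 2 = 0 ↔ g = z.im := by
  have h : z = z.im * I := by
    apply Complex.ext <;> simp [hz]
  have h1 : (g : ℂ) ^ 2 + z ^ 2 = ((g ^ 2 - z.im ^ 2 : ℝ) : ℂ) := by
    conv_lhs => rw [h]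
    push_cast
    rw [mul_pow, I_sq]
    ring
  rw [h1, ofReal_eq_zero, sub_eq_zero, sq_eq_sq₀ hg.le hz'.le]

lemma re_eq_zero_of_sq_add_sq_eq_zero {g : ℝ} {z : ℂ} (hg : 0 < g)
    (h : (g : ℂ) ^ 2 + z ^ 2 = 0) : z.re = 0 ∧ z.im ≠ 0 := by
  have h1 : (z - g * I) * (z + g * I) = 0 := by
    linear_combination h - (g : ℂ) ^ 2 * I_sq
  rcases mul_eq_zero.1 h1 with h2 | h2
  · rw [sub_eq_zero.1 h2]
    simp [hg.ne']
  · rw [eq_neg_of_add_eq_zero_left h2]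
    simp [hg.ne']

lemma encard_fiber_of_im_pos {sν : ℕ → ℂ} (henum : CriticalZeroEnumFor riemannZeta sν) {z : ℂ}
    (hz : z.re = 0) (hz' : 0 < z.im) (h0 : riemannZeta (1 / 2 + z) = 0) :
    {ν | (((sν ν).im : ℝ) : ℂ) ^ 2 + z ^ 2 = 0}.encard = analyticOrderAt centeredXi z ∧
      analyticOrderAt centeredXi z ≠ 0 := by
  have hm := henum.2 (1 / 2 + z) (by simp [hz]) (by simpa using hz') h0
  have hne : z ≠ 1 / 2 := by
    rintro rfl
    norm_num at hz
  have hord := analyticOrderAt_centeredXi_of_zeroOfOrder hz.ge hne hm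
  have hs0 : 1 / 2 + z ≠ 0 := fun h => by
    have := congrArg re h
    norm_num [hz] at this
  have hs1 : 1 / 2 + z ≠ 1 := fun h => hne (by linear_combination h)
  have hxi : centeredXi z = 0 := by
    have := centeredXi_sub_half_eq_mul_zeta hs0 hs1 (Gammaℝ_half_add_ne_zero hz.ge)
    rwa [h0, mul_zero, add_sub_cancel_left] at this
  have hord0 : analyticOrderAt centeredXi z ≠ 0 :=
    (differentiable_centeredXi.analyticAt z).analyticOrderAt_ne_zero.2 hxi
  refine ⟨?_, hord0⟩
  have hfib : {ν | (((sν ν).im : ℝ) : ℂ) ^ 2 + z ^ 2 = 0} = {ν | sν ν = 1 / 2 + z} := by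
    ext ν
    simp only [Set.mem_ofPred_eq]
    rw [sq_add_sq_eq_zero_iff hz hz' (henum.1 ν).2.1, Complex.ext_iff]
    simp [(henum.1 ν).1, hz]
  rw [hfib, hord]
  have hcard : Nat.card {ν : ℕ // sν ν = 1 / 2 + z} ≠ 0 := fun h => hord0 (by rw [hord, h]; rfl)
  have hfin : {ν | sν ν = 1 / 2 + z}.Finite := (Nat.card_ne_zero.1 hcard).2
  rw [← hfin.cast_ncard_eq]
  rfl

lemma encard_fiber_eq_of_zeta_eq_zero {sν : ℕ → ℂ} (henum : CriticalZeroEnumFor riemannZeta sν) {z : ℂ}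
    (hz : z.re = 0) (hz' : z.im ≠ 0)
    (h0 : ∀ w : ℂ, (w = z ∨ w = -z) → 0 < w.im → riemannZeta (1 / 2 + w) = 0) :
    {ν | (((sν ν).im : ℝ) : ℂ) ^ 2 + z ^ 2 = 0}.encard = analyticOrderAt centeredXi z := by
  rcases lt_or_gt_of_ne hz' with h | h
  · have h1 : 0 < (-z).im := by simpa using h
    have := (encard_fiber_of_im_pos henum (z := -z) (by simp [hz]) h1 (h0 _ (Or.inr rfl) h1)).1
    rwa [analyticOrderAt_centeredXi_neg, neg_sq] at this
  · exact (encard_fiber_of_im_pos henum hz h (h0 _ (Or.inl rfl) h)).1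

lemma encard_fiber_eq_of_nonempty {sν : ℕ → ℂ} (henum : CriticalZeroEnumFor riemannZeta sν) {z : ℂ}
    {ν : ℕ} (hν : (((sν ν).im : ℝ) : ℂ) ^ 2 + z ^ 2 = 0) :
    {ν | (((sν ν).im : ℝ) : ℂ) ^ 2 + z ^ 2 = 0}.encard = analyticOrderAt centeredXi z := by
  have hpos := (henum.1 ν).2.1
  obtain ⟨hz, hz'⟩ := re_eq_zero_of_sq_add_sq_eq_zero hpos hν
  refine encard_fiber_eq_of_zeta_eq_zero henum hz hz' fun w hw hw' => ?_
  have hw2 : (((sν ν).im : ℝ) : ℂ) ^ 2 + w ^ 2 = 0 := by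
    rcases hw with rfl | rfl
    · exact hν
    · rwa [neg_sq]
  have hwre := (re_eq_zero_of_sq_add_sq_eq_zero hpos hw2).1
  have him := (sq_add_sq_eq_zero_iff hwre hw' hpos).1 hw2
  have : 1 / 2 + w = sν ν := by
    apply Complex.ext
    · simp [hwre, (henum.1 ν).1]
    · simp [him]
  rw [this]
  exact (henum.1 ν).2.2

lemma encard_fiber_le {sν : ℕ → ℂ} (henum : CriticalZeroEnumFor riemannZeta sν) (z : ℂ) :
    {ν | (((sν ν).im : ℝ) : ℂ) ^ 2 + z ^ 2 = 0}.encard ≤ analyticOrderAt centeredXi z := by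
  rcases Set.eq_empty_or_nonempty {ν | (((sν ν).im : ℝ) : ℂ) ^ 2 + z ^ 2 = 0} with h | ⟨ν, hν⟩
  · simp [h]
  · exact (encard_fiber_eq_of_nonempty henum hν).le

lemma riemannZeta_eq_zero_of_centeredXi_eq_zero {z : ℂ} (hz : 0 ≤ z.re) (h : centeredXi z = 0) :
    riemannZeta (1 / 2 + z) = 0 := by
  have hs0 : 1 / 2 + z ≠ 0 := fun h => by
    have := congrArg re h
    simp at this
    linarith
  have hs1 : 1 / 2 + z ≠ 1 := fun h1 => by
    rw [show z = 1 / 2 by linear_combination h1, centeredXi_half] at h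
    norm_num at h
  have hΓ := Gammaℝ_half_add_ne_zero hz
  have h1 := centeredXi_sub_half_eq_mul_zeta hs0 hs1 hΓ
  rw [add_sub_cancel_left, h] at h1
  exact (mul_eq_zero.1 h1.symm).resolve_left
    (mul_ne_zero (mul_ne_zero (div_ne_zero hs0 two_ne_zero) (sub_ne_zero.2 hs1)) hΓ)

lemma encard_fiber_eq {sν : ℕ → ℂ} (henum : CriticalZeroEnumFor riemannZeta sν)
    (hRH : ∀ s : ℂ, riemannZeta s = 0 → 0 ≤ s.re → s.re ≤ 1 → s.re = 1 / 2) (z : ℂ) :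
    {ν | (((sν ν).im : ℝ) : ℂ) ^ 2 + z ^ 2 = 0}.encard = analyticOrderAt centeredXi z := by
  by_cases h : centeredXi z = 0
  · have hnonneg : ∀ w : ℂ, centeredXi w = 0 → 0 ≤ w.re → w.re = 0 := fun w hw hre => by
      have hζ := riemannZeta_eq_zero_of_centeredXi_eq_zero hre hw
      have h1 : (1 / 2 + w).re ≤ 1 := by
        by_contra! hlt
        exact riemannZeta_ne_zero_of_one_le_re hlt.le hζ
      have := hRH _ hζ (by simp; linarith) h1
      simpa using this
    have hre : z.re = 0 := by
      rcases le_total 0 z.re with h1 | h1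
      · exact hnonneg z h h1
      · have := hnonneg (-z) (by rwa [centeredXi_neg]) (by simpa using h1)
        simpa using this
    have him : z.im ≠ 0 := fun h0 => by
      rw [show z = 0 from Complex.ext hre h0] at h
      exact centeredXi_zero_ne_zero h
    refine encard_fiber_eq_of_zeta_eq_zero henum hre him fun w hw _ => ?_
    rcases hw with rfl | rfl
    · exact riemannZeta_eq_zero_of_centeredXi_eq_zero hre.ge h
    · exact riemannZeta_eq_zero_of_centeredXi_eq_zero (by simp [hre]) (by rwa [centeredXi_neg])
  · refine (encard_fiber_le henum z).antisymm ?_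
    rw [(differentiable_centeredXi.analyticAt z).analyticOrderAt_eq_zero.2 h]
    exact zero_le

lemma hfun_factor_eq {ρ : ℂ} (hρ : ρ.re = 1 / 2) (s : ℂ) :
    1 - (s - s ^ 2) / ((‖ρ‖ : ℂ) ^ 2) =
      ((ρ.im : ℂ) ^ 2 + (s - 1 / 2) ^ 2) / ((ρ.im : ℂ) ^ 2 + 1 / 4) := by
  have h := sq_add_quarter_ne_zero ρ.im
  have h1 : (‖ρ‖ : ℂ) ^ 2 = (ρ.im : ℂ) ^ 2 + 1 / 4 := by
    rw [← ofReal_pow, Complex.sq_norm, normSq_apply, hρ]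
    push_cast
    ring
  rw [h1, eq_div_iff h, sub_mul, div_mul_cancel₀ _ h]
  ring

lemma hfun_eq {sν : ℕ → ℂ} (henum : CriticalZeroEnumFor riemannZeta sν) (s : ℂ) :
    hfun sν s = 1 / 2 * ∏' ν, ((((sν ν).im : ℝ) : ℂ) ^ 2 + (s - 1 / 2) ^ 2) /
      ((((sν ν).im : ℝ) : ℂ) ^ 2 + 1 / 4) := by
  rw [hfun]
  congr 1
  exact tprod_congr fun ν => hfun_factor_eq (henum.1 ν).1 s

lemma re_eq_half_of_hfun_eq_zero {sν : ℕ → ℂ} (henum : CriticalZeroEnumFor riemannZeta sν) {s : ℂ}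
    (h : hfun sν s = 0) : s.re = 1 / 2 := by
  have hpos : ∀ ν, 0 < (sν ν).im := fun ν => (henum.1 ν).2.1
  have hsum := summable_of_card_le hpos (A := 1 + 6 * 26) (by norm_num) fun T R hR hT =>
    card_le_of_growth differentiable_centeredXi centeredXi_half hpos (encard_fiber_le henum)
      (by norm_num) (fun R hR w hw => norm_centeredXi_le hR hw) hR hT
  rw [hfun_eq henum] at h
  have h1 := (mul_eq_zero.1 h).resolve_left (by norm_num)
  obtain ⟨ν, hν⟩ : ∃ ν, (((sν ν).im : ℝ) : ℂ) ^ 2 + (s - 1 / 2) ^ 2 = 0 := by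
    by_contra! hne
    refine tprod_one_add_ne_zero_of_summable (fun ν => ?_)
      (summable_norm_factor hsum (s - 1 / 2)) ?_
    · rw [← factor_eq_one_add]
      exact div_ne_zero (hne ν) (sq_add_quarter_ne_zero _)
    · simp_rw [← factor_eq_one_add]
      exact h1
  have := (re_eq_zero_of_sq_add_sq_eq_zero (hpos ν) hν).1
  simp at this
  linarith

/-- The Riemann Hypothesis holds iff `ζ ≡ η` (equality as meromorphic functions, i.e. away
from the pole `s = 1` and the poles `s = 0, -2, -4, …` of `Γ(s/2)`). -/
theorem riemannHypothesis_iff_zeta_eq_eta (sν : ℕ → ℂ)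
    (henum : CriticalZeroEnumFor riemannZeta sν) :
    (∀ s : ℂ, riemannZeta s = 0 → 0 ≤ s.re → s.re ≤ 1 → s.re = 1 / 2) ↔
      ∀ s : ℂ, s ≠ 1 → (∀ n : ℕ, s ≠ -2 * n) → riemannZeta s = etaFun sν s := by
  have hden : ∀ s : ℂ, s ≠ 1 → (∀ n : ℕ, s ≠ -2 * n) → s ≠ 0 ∧ Gammaℝ s ≠ 0 := fun s _ hs =>
    ⟨by simpa using hs 0, fun h => by
      obtain ⟨n, hn⟩ := Gammaℝ_eq_zero_iff.1 h
      exact hs n (by rw [hn]; ring)⟩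
  constructor
  · intro hRH s hs1 hs
    obtain ⟨hs0, hΓ⟩ := hden s hs1 hs
    have h1 := eq_half_mul_tprod_of_even differentiable_centeredXi centeredXi_neg centeredXi_half
      centeredXi_zero_ne_zero (fun ν => (henum.1 ν).2.1) (encard_fiber_eq henum hRH)
      (by norm_num) (fun R hR w hw => norm_centeredXi_le hR hw) (s - 1 / 2)
    rw [← hfun_eq henum, centeredXi_sub_half_eq_mul_zeta hs0 hs1 hΓ] at h1
    rw [etaFun, ← h1, mul_assoc (s / 2 * (s - 1)) ((Real.pi : ℂ) ^ (-s / 2)), ← Gammaℝ_def,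
      mul_div_cancel_left₀ _
        (mul_ne_zero (mul_ne_zero (div_ne_zero hs0 two_ne_zero) (sub_ne_zero.2 hs1)) hΓ)]
  · intro h s hζ hre _
    have hs1 : s ≠ 1 := by
      rintro rfl
      exact riemannZeta_one_ne_zero hζ
    have hs0 : s ≠ 0 := by
      rintro rfl
      rw [riemannZeta_zero] at hζ
      norm_num at hζ
    have hs : ∀ n : ℕ, s ≠ -2 * n := by
      rintro n rfl
      rcases Nat.eq_zero_or_pos n with rfl | hn
      · simp at hs0
      · have : (1 : ℝ) ≤ n := by exact_mod_cast hn
        norm_num at hre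
        linarith
    have h1 := h s hs1 hs
    rw [hζ, etaFun, mul_assoc (s / 2 * (s - 1)), ← Gammaℝ_def, eq_comm, div_eq_zero_iff] at h1
    exact re_eq_half_of_hfun_eq_zero henum (h1.resolve_right
      (mul_ne_zero (mul_ne_zero (div_ne_zero hs0 two_ne_zero) (sub_ne_zero.2 hs1))
        (hden s hs1 hs).2))
end

section
/- The infinite product (1/2)·∏_{ν=1}^∞ (1 − (s − s²)/|s_ν|²) converges locally uniformly on ℂ, so h is an entire function, and h has order at most 1: for every ε > 0 there is a constant C > 0 such that log|h(s)| ≤ C|s|^{1+ε} for all |s| ≥ 1. -/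
open Complex Filter Topology

theorem norm_Gamma_le_Gamma_re {s : ℂ} (hs : 0 < s.re) : ‖Gamma s‖ ≤ Real.Gamma s.re := by
  rw [Complex.Gamma_eq_integral hs, Complex.GammaIntegral, Real.Gamma_eq_integral hs]
  refine (MeasureTheory.norm_integral_le_integral_norm _).trans_eq ?_
  refine MeasureTheory.setIntegral_congr_fun measurableSet_Ioi fun t ht => ?_
  have ht : 0 < t := ht
  simp [norm_cpow_eq_rpow_re_of_pos ht, Complex.norm_exp]

theorem Real.Gamma_le_add_one_rpow_add_one {x : ℝ} (hx : 1 ≤ x) :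
    Real.Gamma x ≤ (x + 1) ^ (x + 1) := by
  have h0 : 0 ≤ Real.Gamma x := Real.Gamma_nonneg_of_nonneg (by linarith)
  have hn : x + 1 ≤ ((⌊x⌋₊ + 1 : ℕ) : ℝ) + 1 := by
    push_cast; linarith [(Nat.lt_floor_add_one x).le]
  have hn' : ((⌊x⌋₊ + 1 : ℕ) : ℝ) ≤ x + 1 := by
    push_cast; linarith [Nat.floor_le (zero_le_one.trans hx)]
  calc Real.Gamma x ≤ x * Real.Gamma x := le_mul_of_one_le_left h0 hx
    _ = Real.Gamma (x + 1) := (Real.Gamma_add_one (by linarith)).symm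
    _ ≤ Real.Gamma (((⌊x⌋₊ + 1 : ℕ) : ℝ) + 1) :=
        Real.Gamma_strictMonoOn_Ici.monotoneOn (by simp only [Set.mem_Ici]; linarith)
          (by simp only [Set.mem_Ici]; linarith) hn
    _ = ((⌊x⌋₊ + 1).factorial : ℝ) := Real.Gamma_nat_eq_factorial _
    _ ≤ (((⌊x⌋₊ + 1 : ℕ) : ℝ)) ^ (⌊x⌋₊ + 1) := by exact_mod_cast Nat.factorial_le_pow _
    _ ≤ (x + 1) ^ (⌊x⌋₊ + 1) := by gcongr
    _ = (x + 1) ^ (((⌊x⌋₊ + 1 : ℕ) : ℝ)) := (Real.rpow_natCast _ _).symm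
    _ ≤ (x + 1) ^ (x + 1) := Real.rpow_le_rpow_of_exponent_le (by linarith) hn'

theorem norm_riemannZeta_le_of_two_le_re {s : ℂ} (hs : 2 ≤ s.re) :
    ‖riemannZeta s‖ ≤ ∑' n : ℕ, 1 / (n : ℝ) ^ 2 := by
  have key (n : ℕ) : ‖1 / (n : ℂ) ^ s‖ ≤ 1 / (n : ℝ) ^ 2 := by
    rcases n.eq_zero_or_pos with rfl | hn
    · have : s ≠ 0 := by rintro rfl; norm_num at hs
      simp [zero_cpow this]
    · rw [norm_div, norm_one, norm_natCast_cpow_of_pos hn, ← Real.rpow_natCast]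
      have : (1 : ℝ) ≤ n := by exact_mod_cast hn
      gcongr
      exact_mod_cast hs
  have hsum : Summable fun n : ℕ => 1 / (n : ℝ) ^ 2 := Real.summable_one_div_nat_pow.2 one_lt_two
  rw [zeta_eq_tsum_one_div_nat_cpow (by linarith)]
  exact tsum_of_norm_bounded hsum.hasSum key

theorem exists_norm_mellin_le {E : Type*} [NormedAddCommGroup E] [NormedSpace ℂ E] {f : ℝ → E}
    (hf : ∀ s, MellinConvergent f s) (a b : ℝ) :
    ∃ K, ∀ s : ℂ, a ≤ s.re → s.re ≤ b → ‖mellin f s‖ ≤ K := by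
  refine ⟨∫ t in Set.Ioi (0 : ℝ), (‖(t : ℂ) ^ ((a : ℂ) - 1) • f t‖ + ‖(t : ℂ) ^ ((b : ℂ) - 1) • f t‖),
    fun s ha hb => ?_⟩
  refine (MeasureTheory.norm_integral_le_integral_norm _).trans ?_
  refine MeasureTheory.setIntegral_mono_on (hf s).norm ((hf a).norm.add (hf b).norm)
    measurableSet_Ioi fun t ht => ?_
  have ht : 0 < t := ht
  simp only [norm_smul, norm_cpow_eq_rpow_re_of_pos ht, ← add_mul]
  gcongr
  simp only [sub_re, ofReal_re, one_re]
  rcases le_total 1 t with h | h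
  · have : t ^ (s.re - 1) ≤ t ^ (b - 1) := Real.rpow_le_rpow_of_exponent_le h (by linarith)
    have := Real.rpow_nonneg ht.le (a - 1)
    linarith
  · have : t ^ (s.re - 1) ≤ t ^ (a - 1) :=
      Real.rpow_le_rpow_of_exponent_ge ht h (by linarith)
    have := Real.rpow_nonneg ht.le (b - 1)
    linarith

theorem WeakFEPair.mellinConvergent_f_modif {E : Type*} [NormedAddCommGroup E] [NormedSpace ℂ E]
    (P : WeakFEPair E) (s : ℂ) : MellinConvergent P.f_modif s :=
  (P.isStrongFEPair_toStrongFEPair.hasMellin s).1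

theorem exists_norm_completedRiemannZeta₀_le_of_re_mem (a b : ℝ) :
    ∃ K, ∀ s : ℂ, a ≤ s.re → s.re ≤ b → ‖completedRiemannZeta₀ s‖ ≤ K := by
  obtain ⟨K, hK⟩ := exists_norm_mellin_le
    (HurwitzZeta.hurwitzEvenFEPair 0).mellinConvergent_f_modif (a / 2) (b / 2)
  refine ⟨K / 2, fun s ha hb => ?_⟩
  have hre : (s / 2).re = s.re / 2 := by simp
  have : ‖(HurwitzZeta.hurwitzEvenFEPair 0).Λ₀ (s / 2)‖ ≤ K := hK _ (by linarith) (by linarith)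
  rw [completedRiemannZeta₀, HurwitzZeta.completedHurwitzZetaEven₀, norm_div, Complex.norm_ofNat]
  gcongr

theorem norm_Gammaℝ_le_of_two_le_re {s : ℂ} (hs : 2 ≤ s.re) :
    ‖Gammaℝ s‖ ≤ (‖s‖ + 1) ^ (‖s‖ + 1) := by
  have hre : (s / 2).re = s.re / 2 := by simp
  have hs' : s.re ≤ ‖s‖ := re_le_norm s
  have h1 : ‖(Real.pi : ℂ) ^ (-s / 2)‖ ≤ 1 := by
    rw [norm_cpow_eq_rpow_re_of_pos Real.pi_pos]
    refine Real.rpow_le_one_of_one_le_of_nonpos (by linarith [Real.pi_gt_three]) ?_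
    have : (-s / 2).re = - s.re / 2 := by simp
    linarith
  have h2 : ‖Gamma (s / 2)‖ ≤ (‖s‖ + 1) ^ (‖s‖ + 1) := calc
    ‖Gamma (s / 2)‖ ≤ Real.Gamma (s / 2).re := norm_Gamma_le_Gamma_re (by linarith)
    _ ≤ ((s / 2).re + 1) ^ ((s / 2).re + 1) := Real.Gamma_le_add_one_rpow_add_one (by linarith)
    _ ≤ (‖s‖ + 1) ^ ((s / 2).re + 1) :=
        Real.rpow_le_rpow (by linarith) (by linarith) (by linarith)
    _ ≤ (‖s‖ + 1) ^ (‖s‖ + 1) :=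
        Real.rpow_le_rpow_of_exponent_le (by linarith [norm_nonneg s]) (by linarith)
  rw [Gammaℝ_def, norm_mul]
  simpa using mul_le_mul h1 h2 (norm_nonneg _) zero_le_one

theorem exists_norm_completedRiemannZeta₀_le :
    ∃ K, 1 ≤ K ∧ ∀ s : ℂ, ‖completedRiemannZeta₀ s‖ ≤ K * (‖s‖ + 2) ^ (‖s‖ + 2) := by
  obtain ⟨K₀, hK₀⟩ := exists_norm_completedRiemannZeta₀_le_of_re_mem (-1) 2
  set Z := ∑' n : ℕ, 1 / (n : ℝ) ^ 2
  have hZ : 0 ≤ Z := tsum_nonneg fun n => by positivity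
  have right {s : ℂ} (hs : 2 ≤ s.re) :
      ‖completedRiemannZeta₀ s‖ ≤ (Z + 2) * (‖s‖ + 1) ^ (‖s‖ + 1) := by
    have hs' : s.re ≤ ‖s‖ := re_le_norm s
    have hs0 : s ≠ 0 := by rintro rfl; norm_num at hs
    have h1 : completedRiemannZeta₀ s = Gammaℝ s * riemannZeta s + 1 / s + 1 / (1 - s) := by
      rw [riemannZeta_def_of_ne_zero hs0, mul_div_cancel₀ _ (Gammaℝ_ne_zero_of_re_pos (by linarith)),
        completedRiemannZeta_eq]
      ring
    have h2 : ‖1 / s‖ ≤ 1 := by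
      rw [norm_div, norm_one]
      exact div_le_one_of_le₀ (by linarith) (norm_nonneg _)
    have h3 : ‖1 / (1 - s)‖ ≤ 1 := by
      rw [norm_div, norm_one]
      have := abs_re_le_norm (1 - s)
      rw [sub_re, one_re] at this
      exact div_le_one_of_le₀ (by linarith [neg_abs_le (1 - s.re)]) (norm_nonneg _)
    have h4 : 1 ≤ (‖s‖ + 1) ^ (‖s‖ + 1) :=
      Real.one_le_rpow (by linarith [norm_nonneg s]) (by positivity)
    calc ‖completedRiemannZeta₀ s‖ ≤ ‖Gammaℝ s‖ * ‖riemannZeta s‖ + 1 + 1 := by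
          rw [h1, ← norm_mul]
          exact (norm_add₃_le).trans (by gcongr)
      _ ≤ (‖s‖ + 1) ^ (‖s‖ + 1) * Z + 1 + 1 := by
          gcongr
          · exact norm_Gammaℝ_le_of_two_le_re hs
          · exact norm_riemannZeta_le_of_two_le_re hs
      _ ≤ _ := by linarith
  refine ⟨max K₀ (Z + 2), le_max_of_le_right (by linarith), fun s => ?_⟩
  have hb : 1 ≤ (‖s‖ + 2) ^ (‖s‖ + 2) :=
    Real.one_le_rpow (by linarith [norm_nonneg s]) (by positivity)
  have mono {x y : ℝ} (hx : 1 ≤ x) (hxy : x ≤ y) : x ^ x ≤ y ^ y :=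
    (Real.rpow_le_rpow (by linarith) hxy (by linarith)).trans
      (Real.rpow_le_rpow_of_exponent_le (hx.trans hxy) hxy)
  rcases le_or_gt 2 s.re with h | h
  · refine (right h).trans ?_
    gcongr
    · exact le_max_right _ _
    · exact mono (by linarith [norm_nonneg s]) (by linarith)
  rcases le_or_gt (-1) s.re with h' | h'
  · exact (hK₀ s h' h.le).trans ((le_max_left _ _).trans
      (le_mul_of_one_le_right (le_max_of_le_right (by linarith)) hb))
  · rw [← completedRiemannZeta₀_one_sub]
    refine (right (by rw [sub_re, one_re]; linarith)).trans ?_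
    have := norm_sub_le 1 s
    rw [norm_one] at this
    gcongr
    · exact le_max_right _ _
    · exact mono (by linarith [norm_nonneg (1 - s)]) (by linarith)

/-- The entire function `s (s - 1) Λ₀(s) + 1`, equal to `s (s - 1) Λ(s)` away from `0` and `1`. -/
noncomputable def entireXi (s : ℂ) : ℂ := s * (s - 1) * completedRiemannZeta₀ s + 1

theorem differentiable_entireXi : Differentiable ℂ entireXi :=
  ((differentiable_id.mul (differentiable_id.sub_const 1)).mul
    differentiable_completedZeta₀).add_const 1

theorem entireXi_zero : entireXi 0 = 1 := by simp [entireXi]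

theorem entireXi_eq {s : ℂ} (hs : 0 < s.re) (hs1 : s ≠ 1) :
    entireXi s = s * (s - 1) * Gammaℝ s * riemannZeta s := by
  have hs0 : s ≠ 0 := by rintro rfl; simp at hs
  have hs1' : 1 - s ≠ 0 := sub_ne_zero.2 hs1.symm
  rw [riemannZeta_def_of_ne_zero hs0, mul_assoc (s * (s - 1)),
    mul_div_cancel₀ _ (Gammaℝ_ne_zero_of_re_pos hs), completedRiemannZeta_eq, entireXi]
  field_simp
  ring

/-- Zeros of an entire function, counted with multiplicity, can be divided out. -/
theorem Differentiable.exists_eq_prod_sub_mul {ι : Type*} [DecidableEq ι] {F : ℂ → ℂ}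
    (hF : Differentiable ℂ F) (N : Finset ι) (ρ : ι → ℂ)
    (hN : ∀ z, ((N.filter (ρ · = z)).card : ℕ∞) ≤ analyticOrderAt F z) :
    ∃ G : ℂ → ℂ, Differentiable ℂ G ∧ ∀ z, F z = (∏ i ∈ N, (z - ρ i)) * G z := by
  induction N using Finset.induction generalizing F with
  | empty => exact ⟨F, hF, by simp⟩
  | insert i N hi ih =>
    set p := ρ i
    have hp : F p = 0 := by
      refine apply_eq_zero_of_analyticOrderAt_ne_zero fun h0 => ?_
      have := hN p
      rw [h0, Finset.filter_insert, if_pos rfl, Finset.card_insert_of_notMem (by simp [hi])] at this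
      simp at this
    set H := dslope F p with hHdef
    have hH : Differentiable ℂ H := by
      rw [← differentiableOn_univ, differentiableOn_dslope univ_mem]
      exact hF.differentiableOn
    have hFH (z : ℂ) : F z = (z - p) * H z := by
      have := sub_smul_dslope F p z
      rw [hp, sub_zero, smul_eq_mul] at this
      exact this.symm
    obtain ⟨G, hG, hHG⟩ := ih hH fun z => by
      have hz := hN z
      have hlin : AnalyticAt ℂ (fun w => w - p) z := by fun_prop
      rw [show F = (fun w => w - p) * H from funext hFH,
        analyticOrderAt_mul hlin (hH.analyticAt z), Finset.filter_insert] at hz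
      by_cases hpz : p = z
      · rw [if_pos hpz, Finset.card_insert_of_notMem (by simp [hi]), ← hpz,
          analyticOrderAt_id_sub_const_self, Nat.cast_add, Nat.cast_one, add_comm] at hz
        rw [← hpz]
        exact (ENat.add_le_add_iff_left ENat.one_ne_top).1 hz
      · rwa [if_neg hpz, analyticOrderAt_id_sub_const_of_ne (Ne.symm hpz), zero_add] at hz
    refine ⟨G, hG, fun z => ?_⟩
    rw [Finset.prod_insert hi, hFH, hHG, mul_assoc]

/-- A Jensen-type bound for the number of zeros in a disc. -/
theorem card_mul_log_two_le_of_entire {ι : Type*} [DecidableEq ι] {F : ℂ → ℂ}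
    (hF : Differentiable ℂ F) (hF0 : F 0 = 1) (N : Finset ι) (ρ : ι → ℂ)
    (hN : ∀ z, ((N.filter (ρ · = z)).card : ℕ∞) ≤ analyticOrderAt F z)
    {r M : ℝ} (hr : 0 < r) (hρ : ∀ i ∈ N, ‖ρ i‖ ≤ r) (hM : ∀ z, ‖z‖ = 3 * r → ‖F z‖ ≤ M) :
    N.card * Real.log 2 ≤ Real.log M := by
  obtain ⟨G, hG, hFG⟩ := hF.exists_eq_prod_sub_mul N ρ hN
  have hG0 : ‖G 0‖ ≤ M / (2 * r) ^ N.card := by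
    refine Complex.norm_le_of_forall_mem_frontier_norm_le (U := Metric.ball 0 (3 * r))
      Metric.isBounded_ball hG.diffContOnCl (fun z hz => ?_)
      (subset_closure (Metric.mem_ball_self (by positivity)))
    rw [frontier_ball _ (by positivity), mem_sphere_zero_iff_norm] at hz
    rw [le_div_iff₀ (by positivity)]
    refine le_trans ?_ (hM z hz)
    rw [hFG, norm_mul, norm_prod, mul_comm]
    gcongr
    rw [← Finset.prod_const]
    refine Finset.prod_le_prod (fun _ _ => by positivity) fun i hi => ?_
    have := norm_sub_norm_le z (ρ i)
    linarith [hρ i hi]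
  have h1 : 1 ≤ r ^ N.card * ‖G 0‖ := by
    have := congrArg norm (hFG 0)
    rw [hF0, norm_one, norm_mul, norm_prod] at this
    rw [this]
    gcongr
    rw [← Finset.prod_const]
    exact Finset.prod_le_prod (fun _ _ => norm_nonneg _) fun i hi => by simpa using hρ i hi
  have h2 : (2 : ℝ) ^ N.card ≤ M := by
    have h3 : 1 ≤ r ^ N.card * (M / (2 * r) ^ N.card) := h1.trans (by gcongr)
    rw [mul_pow, mul_div_assoc', mul_comm, mul_div_mul_right _ _ (by positivity),
      le_div_iff₀ (by positivity), one_mul] at h3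
    exact h3
  rw [← Real.log_pow]
  exact Real.log_le_log (by positivity) h2

theorem analyticAt_Gammaℝ {s : ℂ} (hs : 0 < s.re) : AnalyticAt ℂ Gammaℝ s := by
  have := (differentiable_Gammaℝ_inv.analyticAt s).inv (inv_ne_zero (Gammaℝ_ne_zero_of_re_pos hs))
  refine this.congr (Eventually.of_forall fun z => ?_)
  simp

theorem CriticalZeroEnumFor.card_filter_le_analyticOrderAt_entireXi {sν : ℕ → ℂ}
    (henum : CriticalZeroEnumFor riemannZeta sν) (N : Finset ℕ) (z : ℂ) :
    ((N.filter (sν · = z)).card : ℕ∞) ≤ analyticOrderAt entireXi z := by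
  by_cases hz : ∃ ν, sν ν = z
  swap
  · rw [Finset.filter_false_of_mem fun ν _ h => hz ⟨ν, h⟩]
    simp
  obtain ⟨ν, hν⟩ := hz
  obtain ⟨hre, him, hζ⟩ := henum.1 ν
  rw [hν] at hre him hζ
  have hre0 : 0 < z.re := by rw [hre]; norm_num
  have hz1 : z ≠ 1 := by rintro rfl; simp at him
  obtain ⟨g, hg, hg0, hfg⟩ := henum.2 z hre him hζ
  have hζg : riemannZeta =ᶠ[𝓝 z]
      fun w => (w - z) ^ Nat.card {ν : ℕ // sν ν = z} * g w := by
    refine (ContinuousAt.eventuallyEq_nhds_iff_eventuallyEq_nhdsNE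
      (differentiableAt_riemannZeta hz1).continuousAt ?_).1 hfg
    have := hg.continuousAt
    fun_prop
  have hm : Nat.card {ν : ℕ // sν ν = z} ≠ 0 := fun h0 => by
    have := hζg.eq_of_nhds
    rw [h0, hζ, pow_zero, one_mul] at this
    exact hg0 this.symm
  have : Finite {ν : ℕ // sν ν = z} := Nat.finite_of_card_ne_zero hm
  have hcard : (N.filter (sν · = z)).card ≤ Nat.card {ν : ℕ // sν ν = z} := by
    rw [← Nat.card_eq_finsetCard]
    exact Nat.card_le_card_of_injective
      (fun i => (⟨i, (Finset.mem_filter.1 i.2).2⟩ : {ν : ℕ // sν ν = z}))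
      fun i j h => Subtype.ext (Subtype.mk.inj h)
  refine le_trans (by exact_mod_cast hcard)
    ((natCast_le_analyticOrderAt (differentiable_entireXi.analyticAt z)).2
      ⟨fun w => w * (w - 1) * Gammaℝ w * g w, ?_, ?_⟩)
  · have := analyticAt_Gammaℝ hre0
    fun_prop
  · have h1 : ∀ᶠ w : ℂ in 𝓝 z, 0 < w.re := continuous_re.continuousAt.eventually_const_lt hre0
    filter_upwards [hζg, h1, eventually_ne_nhds hz1] with w hw hw0 hw1
    rw [entireXi_eq hw0 hw1, hw, smul_eq_mul]
    ring

theorem exists_norm_entireXi_le :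
    ∃ K, 1 ≤ K ∧ ∀ s : ℂ, ‖entireXi s‖ ≤ K * (‖s‖ + 2) ^ (‖s‖ + 4) := by
  obtain ⟨K, hK, hle⟩ := exists_norm_completedRiemannZeta₀_le
  refine ⟨K + 1, by linarith, fun s => ?_⟩
  have h0 := norm_nonneg s
  have h1 : ‖s * (s - 1)‖ ≤ (‖s‖ + 2) ^ 2 := by
    have := norm_sub_le s 1
    rw [norm_one] at this
    rw [norm_mul, sq]
    gcongr <;> linarith
  have h2 : 1 ≤ (‖s‖ + 2) ^ (‖s‖ + 4) := Real.one_le_rpow (by linarith) (by linarith)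
  calc ‖entireXi s‖ ≤ ‖s * (s - 1)‖ * ‖completedRiemannZeta₀ s‖ + 1 := by
        rw [← norm_mul, ← norm_one (α := ℂ)]; exact norm_add_le _ _
    _ ≤ (‖s‖ + 2) ^ 2 * (K * (‖s‖ + 2) ^ (‖s‖ + 2)) + 1 := by gcongr; exact hle s
    _ = K * (‖s‖ + 2) ^ (‖s‖ + 4) + 1 := by
        rw [show ‖s‖ + 4 = (‖s‖ + 2) + (2 : ℕ) by push_cast; ring, Real.rpow_add_natCast (by positivity)]
        ring
    _ ≤ _ := by linarith

theorem CriticalZeroEnumFor.exists_card_le {sν : ℕ → ℂ}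
    (henum : CriticalZeroEnumFor riemannZeta sν) {δ : ℝ} (hδ : 0 < δ) :
    ∃ C, 0 ≤ C ∧ ∀ r : ℝ, 1 ≤ r → ∀ N : Finset ℕ, (∀ ν ∈ N, ‖sν ν‖ ≤ r) →
      (N.card : ℝ) ≤ C * r ^ (1 + δ) := by
  obtain ⟨K, hK, hle⟩ := exists_norm_entireXi_le
  have hl2 : 0 < Real.log 2 := Real.log_pos one_lt_two
  have hlK : 0 ≤ Real.log K := Real.log_nonneg hK
  refine ⟨(Real.log K + 7 * (5 ^ δ / δ)) / Real.log 2, by positivity, fun r hr N hN => ?_⟩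
  have hr0 : 0 < r := by linarith
  have hJ := card_mul_log_two_le_of_entire differentiable_entireXi entireXi_zero N sν
    (henum.card_filter_le_analyticOrderAt_entireXi N) hr0 hN
    (M := K * (3 * r + 2) ^ (3 * r + 4)) fun z hz => hz ▸ hle z
  rw [Real.log_mul (by positivity) (by positivity), Real.log_rpow (by positivity)] at hJ
  have h1 : Real.log (3 * r + 2) ≤ 5 ^ δ / δ * r ^ δ := calc
    Real.log (3 * r + 2) ≤ (3 * r + 2) ^ δ / δ := Real.log_le_rpow_div (by positivity) hδ
    _ ≤ (5 * r) ^ δ / δ := by gcongr; linarith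
    _ = _ := by rw [Real.mul_rpow (by norm_num) hr0.le]; ring
  have h2 : 1 ≤ r ^ (1 + δ) := Real.one_le_rpow hr (by positivity)
  rw [div_mul_eq_mul_div, le_div_iff₀ hl2]
  calc N.card * Real.log 2 ≤ Real.log K + (3 * r + 4) * Real.log (3 * r + 2) := hJ
    _ ≤ Real.log K * r ^ (1 + δ) + (7 * r) * (5 ^ δ / δ * r ^ δ) := by
        gcongr
        · exact le_mul_of_one_le_right hlK h2
        · exact Real.log_nonneg (by linarith)
        · linarith
    _ = _ := by rw [Real.rpow_add hr0, Real.rpow_one]; ring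

/-- A family of positive reals whose counting function is `O(r ^ b)` has exponent of convergence
at most `b`. -/
theorem summable_rpow_neg_of_card_le {ι : Type*} [DecidableEq ι] {x : ι → ℝ}
    (hx : ∀ i, 1 / 2 ≤ x i) {C a b : ℝ} (hC : 0 ≤ C) (ha : 0 ≤ a) (hab : b < a)
    (hcard : ∀ r : ℝ, 1 ≤ r → ∀ N : Finset ι, (∀ i ∈ N, x i ≤ r) → (N.card : ℝ) ≤ C * r ^ b) :
    Summable fun i => x i ^ (-a) := by
  have hx0 (i : ι) : 0 < x i := by linarith [hx i]
  set k : ι → ℕ := fun i => Nat.log 2 ⌊2 * x i⌋₊ with hk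
  have hfl (i : ι) : ⌊2 * x i⌋₊ ≠ 0 := (Nat.floor_pos.2 (by linarith [hx i])).ne'
  have hlow (i : ι) : (2 : ℝ) ^ k i ≤ 2 * x i :=
    le_trans (by exact_mod_cast Nat.pow_log_le_self 2 (hfl i))
      (Nat.floor_le (by linarith [hx0 i]))
  have hupp (i : ι) : x i ≤ (2 : ℝ) ^ k i := by
    have h1 : 2 * x i < 2 ^ (k i + 1) := (Nat.floor_lt (by linarith [hx0 i])).1
      (Nat.lt_pow_succ_log_self one_lt_two _) |>.trans_eq (by push_cast; rfl)
    rw [pow_succ] at h1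
    linarith
  set q : ℝ := 2 ^ (b - a) with hq
  have hq1 : q < 1 := Real.rpow_lt_one_of_one_lt_of_neg one_lt_two (by linarith)
  have hsum : Summable fun n : ℕ => C * 2 ^ a * q ^ n :=
    (summable_geometric_of_lt_one (by positivity) hq1).mul_left _
  refine summable_of_sum_le (c := ∑' n : ℕ, C * 2 ^ a * q ^ n)
    (fun i => Real.rpow_nonneg (hx0 i).le _) fun N => ?_
  rw [← Finset.sum_fiberwise_of_maps_to (g := k) (t := N.image k)
    fun i hi => Finset.mem_image_of_mem k hi]
  refine le_trans (Finset.sum_le_sum fun n _ => ?_) (hsum.sum_le_tsum _ fun n _ => by positivity)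
  have hterm : ∀ i ∈ N.filter (k · = n), x i ^ (-a) ≤ 2 ^ a * ((2 : ℝ) ^ n) ^ (-a) := by
    intro i hi
    rw [← (Finset.mem_filter.1 hi).2]
    calc x i ^ (-a) ≤ (2⁻¹ * 2 ^ k i) ^ (-a) :=
          Real.rpow_le_rpow_of_nonpos (by positivity) (by linarith [hlow i]) (by linarith)
      _ = _ := by
          rw [Real.mul_rpow (by positivity) (by positivity), Real.inv_rpow (by positivity),
            Real.rpow_neg (by positivity), inv_inv]
  have hc := hcard (2 ^ n) (one_le_pow₀ one_le_two) (N.filter (k · = n)) fun i hi => by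
    rw [← (Finset.mem_filter.1 hi).2]; exact hupp i
  calc ∑ i ∈ N.filter (k · = n), x i ^ (-a)
      ≤ (N.filter (k · = n)).card * (2 ^ a * ((2 : ℝ) ^ n) ^ (-a)) := by
        simpa using Finset.sum_le_card_nsmul _ _ _ hterm
    _ ≤ (C * ((2 : ℝ) ^ n) ^ b) * (2 ^ a * ((2 : ℝ) ^ n) ^ (-a)) := by gcongr
    _ = C * 2 ^ a * q ^ n := by
        have : q ^ n = ((2 : ℝ) ^ n) ^ b * ((2 : ℝ) ^ n) ^ (-a) := by
          rw [← Real.rpow_add (by positivity), hq, ← sub_eq_add_neg, Real.rpow_pow_comm two_pos.le]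
        rw [this]
        ring

theorem CriticalZeroEnumFor.summable_norm_rpow_neg {sν : ℕ → ℂ}
    (henum : CriticalZeroEnumFor riemannZeta sν) {a : ℝ} (ha : 1 < a) :
    Summable fun ν => ‖sν ν‖ ^ (-a) := by
  obtain ⟨C, hC, hcard⟩ := henum.exists_card_le (δ := (a - 1) / 2) (by linarith)
  refine summable_rpow_neg_of_card_le (fun ν => ?_) hC (by linarith) (by linarith) hcard
  have := re_le_norm (sν ν)
  rwa [(henum.1 ν).1] at this

theorem one_add_le_exp_rpow_div {x p : ℝ} (hx : 0 ≤ x) (hp : 0 < p) (hp1 : p ≤ 1) :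
    1 + x ≤ Real.exp (x ^ p / p) := by
  have h1 : (1 + x) ^ p ≤ 1 + x ^ p := by
    simpa using Real.rpow_add_le_add_rpow zero_le_one hx hp.le hp1
  have h2 : (1 + x) ^ p ≤ Real.exp (x ^ p) := by
    linarith [Real.add_one_le_exp (x ^ p)]
  have h3 := Real.rpow_le_rpow (by positivity) h2 (inv_nonneg.2 hp.le)
  rwa [Real.rpow_rpow_inv (by positivity) hp.ne', ← Real.exp_mul, ← div_eq_mul_inv] at h3

theorem norm_tprod_one_add_le_exp {ι : Type*} {f : ι → ℂ} {p : ℝ} (hp : 0 < p) (hp1 : p ≤ 1)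
    (hf : Multipliable fun i => 1 + f i) (hsum : Summable fun i => ‖f i‖ ^ p) :
    ‖∏' i, (1 + f i)‖ ≤ Real.exp ((∑' i, ‖f i‖ ^ p) / p) := by
  refine le_of_tendsto hf.hasProd.norm (Eventually.of_forall fun N => ?_)
  calc ∏ i ∈ N, ‖1 + f i‖ ≤ ∏ i ∈ N, Real.exp (‖f i‖ ^ p / p) :=
        Finset.prod_le_prod (fun _ _ => norm_nonneg _) fun i _ =>
          ((norm_add_le _ _).trans_eq (by rw [norm_one])).trans
            (one_add_le_exp_rpow_div (norm_nonneg _) hp hp1)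
    _ = Real.exp ((∑ i ∈ N, ‖f i‖ ^ p) / p) := by rw [← Real.exp_sum, Finset.sum_div]
    _ ≤ Real.exp ((∑' i, ‖f i‖ ^ p) / p) := by
        gcongr
        exact hsum.sum_le_tsum _ fun i _ => by positivity

/-- The product defining `h` converges locally uniformly on `ℂ`, `h` is entire,
and `h` has order at most `1`: for every `ε > 0` there is `C > 0` with
`log |h(s)| ≤ C |s|^{1+ε}` for `|s| ≥ 1`. -/
theorem hfun_entire_order_le_one (sν : ℕ → ℂ)
    (henum : CriticalZeroEnumFor riemannZeta sν) :
    (∀ s : ℂ, Multipliable fun ν : ℕ => 1 - (s - s ^ 2) / ((‖sν ν‖ : ℂ) ^ 2)) ∧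
    TendstoLocallyUniformly
      (fun (N : Finset ℕ) (s : ℂ) =>
        (1 / 2 : ℂ) * ∏ ν ∈ N, (1 - (s - s ^ 2) / ((‖sν ν‖ : ℂ) ^ 2)))
      (hfun sν) atTop ∧
    Differentiable ℂ (hfun sν) ∧
    ∀ ε : ℝ, 0 < ε → ∃ C : ℝ, 0 < C ∧ ∀ s : ℂ, 1 ≤ ‖s‖ →
      Real.log ‖hfun sν s‖ ≤ C * ‖s‖ ^ (1 + ε) := by
  have hpos (ν : ℕ) : 0 < ‖sν ν‖ := by
    have := re_le_norm (sν ν)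
    rw [(henum.1 ν).1] at this
    linarith
  set f : ℕ → ℂ → ℂ := fun ν s => -((s - s ^ 2) / ((‖sν ν‖ : ℂ) ^ 2)) with hf
  have hfnorm (ν : ℕ) (s : ℂ) : ‖f ν s‖ = ‖s - s ^ 2‖ * ‖sν ν‖ ^ (-2 : ℝ) := by
    rw [Real.rpow_neg (norm_nonneg _), Real.rpow_ofNat]
    simp [hf, div_eq_mul_inv]
  have hsum2 : Summable fun ν => ‖sν ν‖ ^ (-2 : ℝ) := henum.summable_norm_rpow_neg one_lt_two
  have hmul (s : ℂ) : Multipliable fun ν => 1 + f ν s :=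
    multipliable_one_add_of_summable (by simpa only [hfnorm] using hsum2.mul_left _)
  have hfcont (ν : ℕ) : Differentiable ℂ (f ν) := by
    simp only [hf]
    fun_prop
  have hloc : TendstoLocallyUniformly (fun (N : Finset ℕ) (s : ℂ) => ∏ ν ∈ N, (1 + f ν s))
      (fun s => ∏' ν, (1 + f ν s)) atTop := by
    have := hasProdLocallyUniformly_of_forall_compact (f := fun ν s => 1 + f ν s)
      (g := fun s => ∏' ν, (1 + f ν s)) fun K hK => by
        obtain ⟨B, hB⟩ := hK.exists_bound_of_continuousOn
          (f := fun s : ℂ => s - s ^ 2) (by fun_prop)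
        refine Summable.hasProdUniformlyOn_one_add hK (hsum2.mul_left B)
          (Eventually.of_forall fun ν s hs => ?_) fun ν => (hfcont ν).continuous.continuousOn
        rw [hfnorm]
        exact mul_le_mul_of_nonneg_right (hB s hs) (by positivity)
    rw [hasProdLocallyUniformly_iff_tendstoLocallyUniformly] at this
    exact this
  have hlocHalf : TendstoLocallyUniformly
      (fun (N : Finset ℕ) (s : ℂ) => (1 / 2 : ℂ) * ∏ ν ∈ N, (1 + f ν s)) (hfun sν) atTop :=
    (uniformContinuous_const_smul (1 / 2 : ℂ)).comp_tendstoLocallyUniformly hloc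
  simp only [sub_eq_add_neg (1 : ℂ)]
  refine ⟨hmul, hlocHalf, ?_, fun ε hε => ?_⟩
  · rw [← differentiableOn_univ]
    refine (tendstoLocallyUniformlyOn_univ.2 hlocHalf).differentiableOn
      (Eventually.of_forall fun N => ?_) isOpen_univ
    fun_prop
  · set p : ℝ := (1 + min ε 1) / 2 with hp
    have hε' : 0 < min ε 1 := lt_min hε one_pos
    have hp0 : 0 < p := by positivity
    have hp1 : p ≤ 1 := by linarith [min_le_right ε 1]
    have hsum := henum.summable_norm_rpow_neg (a := 2 * p) (by linarith)
    set S := ∑' ν, ‖sν ν‖ ^ (-(2 * p)) with hS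
    have hS0 : 0 ≤ S := tsum_nonneg fun ν => by positivity
    have hfp (ν : ℕ) (s : ℂ) : ‖f ν s‖ ^ p = ‖s - s ^ 2‖ ^ p * ‖sν ν‖ ^ (-(2 * p)) := by
      rw [hfnorm, Real.mul_rpow (norm_nonneg _) (by positivity), ← Real.rpow_mul (norm_nonneg _),
        neg_mul]
    refine ⟨2 ^ p * S / p + 1, by positivity, fun s hs => ?_⟩
    have hs2 : ‖s - s ^ 2‖ ≤ 2 * ‖s‖ ^ 2 := by
      have := norm_sub_le s (s ^ 2)
      rw [norm_pow] at this
      nlinarith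
    have hsp : ‖s - s ^ 2‖ ^ p ≤ 2 ^ p * ‖s‖ ^ (1 + ε) := calc
      ‖s - s ^ 2‖ ^ p ≤ (2 * ‖s‖ ^ 2) ^ p := by gcongr
      _ = 2 ^ p * ‖s‖ ^ (1 + min ε 1) := by
          rw [Real.mul_rpow (by positivity) (by positivity), ← Real.rpow_natCast,
            ← Real.rpow_mul (norm_nonneg _)]
          congr 2
          rw [hp]; push_cast; ring
      _ ≤ 2 ^ p * ‖s‖ ^ (1 + ε) := by
          gcongr
          exact min_le_left _ _
    have hexp : ‖hfun sν s‖ ≤ Real.exp (‖s - s ^ 2‖ ^ p * S / p) := by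
      have h1 := norm_tprod_one_add_le_exp hp0 hp1 (hmul s)
        (by simpa only [hfp] using hsum.mul_left _)
      simp only [hfp, tsum_mul_left] at h1
      have h2 : hfun sν s = 1 / 2 * ∏' ν, (1 + f ν s) := rfl
      rw [h2, norm_mul]
      have h3 : ‖(1 / 2 : ℂ)‖ = 1 / 2 := by norm_num
      rw [h3]
      linarith [norm_nonneg (∏' ν, (1 + f ν s))]
    have hlog : Real.log ‖hfun sν s‖ ≤ ‖s - s ^ 2‖ ^ p * S / p := by
      rcases (norm_nonneg (hfun sν s)).eq_or_lt with h0 | h0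
      · rw [← h0, Real.log_zero]; positivity
      · exact (Real.log_le_iff_le_exp h0).2 hexp
    calc Real.log ‖hfun sν s‖ ≤ ‖s - s ^ 2‖ ^ p * S / p := hlog
      _ ≤ 2 ^ p * ‖s‖ ^ (1 + ε) * S / p := by gcongr
      _ = 2 ^ p * S / p * ‖s‖ ^ (1 + ε) := by ring
      _ ≤ _ := by gcongr; linarith
end

section
/- The function η satisfies the Riemann functional equation: η(1 − s) = 2(2π)^{−s} cos(πs/2) Γ(s) η(s) as meromorphic functions on ℂ. -/
open Complex Filter Topology

theorem hfun_one_sub (sν : ℕ → ℂ) (s : ℂ) : hfun sν (1 - s) = hfun sν s := by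
  have h : (1 - s) - (1 - s) ^ 2 = s - s ^ 2 := by ring
  simp only [hfun, h]

theorem etaFun_eq_div_Gammaℝ (sν : ℕ → ℂ) (s : ℂ) :
    etaFun sν s = hfun sν s / (s / 2 * (s - 1) * Gammaℝ s) := by
  rw [etaFun, Gammaℝ_def, mul_assoc (s / 2 * (s - 1))]

/-- `η` satisfies the Riemann functional equation
`η(1-s) = 2 (2π)^{-s} cos(πs/2) Γ(s) η(s)` as meromorphic functions on `ℂ`,
i.e. away from the discrete set `{-n : n ∈ ℕ} ∪ {1 + 2n : n ∈ ℕ}`. -/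
theorem etaFun_functional_equation (sν : ℕ → ℂ)
    (henum : CriticalZeroEnumFor riemannZeta sν) :
    ∀ s : ℂ, (∀ n : ℕ, s ≠ -n) → (∀ n : ℕ, s ≠ 1 + 2 * n) →
      etaFun sν (1 - s) =
        2 * (2 * (Real.pi : ℂ)) ^ (-s) * Complex.cos ((Real.pi : ℂ) * s / 2) *
          Complex.Gamma s * etaFun sν s := by
  intro s hs _
  have hne : Gammaℝ s ≠ 0 := by
    rw [Ne, Gammaℝ_eq_zero_iff]
    rintro ⟨n, hn⟩
    exact hs (2 * n) (by rw [hn]; push_cast; ring)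
  have hdiv := Gammaℝ_div_Gammaℝ_one_sub (s := s) fun n h =>
    hs (2 * n + 1) (by rw [h]; push_cast; ring)
  have hfactor : (1 - s) / 2 * (1 - s - 1) = s / 2 * (s - 1) := by ring
  rw [etaFun_eq_div_Gammaℝ, etaFun_eq_div_Gammaℝ, hfun_one_sub, hfactor,
    mul_right_comm _ (cos _) (Gamma s), ← Gammaℂ_def, ← hdiv]
  rw [div_mul_div_comm, mul_comm (Gammaℝ s) (hfun sν s), mul_comm (Gammaℝ (1 - s)),
    mul_right_comm _ (Gammaℝ s), mul_div_mul_right _ _ hne]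
end

section
/- The function η has a simple pole at s = 1 with residue 1; that is, lim_{s→1} (s − 1)η(s) = 1. Moreover, (s − 1)η(s) extends to an entire function. -/
open Complex Filter Topology

open MeasureTheory Set

/-- The Mellin transform at `-s` of the fractional part on `(1, ∞)`. -/
noncomputable def fractMellin (s : ℂ) : ℂ :=
  mellin ((Ioi (1 : ℝ)).indicator fun t ↦ ((Int.fract t : ℝ) : ℂ)) (-s)

lemma fractMellin_eq_integral (s : ℂ) :
    fractMellin s = ∫ t in Ioi (1 : ℝ), ((Int.fract t : ℝ) : ℂ) * (t : ℂ) ^ (-(s + 1)) := by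
  have h : ∀ t : ℝ, (t : ℂ) ^ (-s - 1) • (Ioi (1 : ℝ)).indicator
      (fun t ↦ ((Int.fract t : ℝ) : ℂ)) t = (Ioi (1 : ℝ)).indicator
      (fun t ↦ ((Int.fract t : ℝ) : ℂ) * (t : ℂ) ^ (-(s + 1))) t := by
    intro t
    by_cases ht : t ∈ Ioi (1 : ℝ)
    · simp only [indicator_of_mem ht, smul_eq_mul, mul_comm, neg_add']
    · simp [indicator_of_notMem ht]
  simp only [fractMellin, mellin, h]
  rw [setIntegral_indicator measurableSet_Ioi, Ioi_inter_Ioi]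
  simp

lemma measurable_ofReal_fract : Measurable fun t : ℝ ↦ ((Int.fract t : ℝ) : ℂ) :=
  Complex.measurable_ofReal.comp measurable_fract

lemma norm_ofReal_fract_le_one (t : ℝ) : ‖((Int.fract t : ℝ) : ℂ)‖ ≤ 1 := by
  rw [Complex.norm_real, Real.norm_of_nonneg (Int.fract_nonneg t)]
  exact (Int.fract_lt_one t).le

lemma differentiableAt_fractMellin {s : ℂ} (hs : 0 < s.re) :
    DifferentiableAt ℂ fractMellin s := by
  have hle : ∀ t : ℝ, ‖(Ioi (1 : ℝ)).indicator (fun t ↦ ((Int.fract t : ℝ) : ℂ)) t‖ ≤ 1 :=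
    fun t ↦ (norm_indicator_le_norm_self _ _).trans (norm_ofReal_fract_le_one t)
  have hloc : LocallyIntegrable ((Ioi (1 : ℝ)).indicator fun t ↦ ((Int.fract t : ℝ) : ℂ)) := by
    refine (locallyIntegrable_const (1 : ℝ)).mono
      (measurable_ofReal_fract.indicator measurableSet_Ioi).aestronglyMeasurable ?_
    exact Eventually.of_forall fun t ↦ by simpa using hle t
  refine DifferentiableAt.comp (g := mellin _) s
    (mellin_differentiableAt_of_isBigO_rpow (a := 0) (b := -s.re - 1)
      (hloc.locallyIntegrableOn _) ?_ (by simpa using hs) ?_ (by simp)) (by fun_prop)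
  · exact Asymptotics.IsBigO.of_bound 1 (Eventually.of_forall fun t ↦ by simpa using hle t)
  · have h1 : ∀ᶠ t : ℝ in 𝓝[>] 0, t < 1 :=
      eventually_nhdsWithin_of_eventually_nhds (eventually_lt_nhds one_pos)
    refine Asymptotics.IsBigO.of_bound 1 (h1.mono fun t ht ↦ ?_)
    rw [indicator_of_notMem (by simpa using ht.le)]
    simp

lemma norm_fractMellin_le {s : ℂ} (hs : 0 < s.re) : ‖fractMellin s‖ ≤ 1 / s.re := by
  have hint : IntegrableOn (fun t : ℝ ↦ t ^ (-(s.re + 1))) (Ioi 1) :=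
    integrableOn_Ioi_rpow_of_lt (by linarith) one_pos
  have hval : ∫ t in Ioi (1 : ℝ), t ^ (-(s.re + 1)) = 1 / s.re := by
    rw [integral_Ioi_rpow_of_lt (by linarith) one_pos]
    simp [neg_div]
  rw [fractMellin_eq_integral, ← hval]
  refine norm_integral_le_of_norm_le hint ?_
  refine (ae_restrict_iff' measurableSet_Ioi).mpr (Eventually.of_forall fun t ht ↦ ?_)
  have ht0 : 0 < t := one_pos.trans ht
  rw [norm_mul, Complex.norm_cpow_eq_rpow_re_of_pos ht0]
  simpa using mul_le_mul_of_nonneg_right (norm_ofReal_fract_le_one t)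
    (Real.rpow_nonneg ht0.le (-(s.re + 1)))

lemma riemannZeta_eq_sub_fractMellin {s : ℂ} (hs : 1 < s.re) :
    riemannZeta s = s / (s - 1) - s * fractMellin s := by
  have hs0 : s - 1 ≠ 0 := fun h ↦ by
    rw [sub_eq_zero.mp h, Complex.one_re] at hs
    exact lt_irrefl _ hs
  have hO : (fun n : ℕ ↦ ∑ k ∈ Finset.Icc 1 n, ‖(1 : ℕ → ℂ) k‖) =O[atTop]
      fun n ↦ (n : ℝ) ^ (1 : ℝ) := by
    refine Asymptotics.IsBigO.of_bound 1 (Eventually.of_forall fun n ↦ ?_)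
    simp
  have hpow : IntegrableOn (fun t : ℝ ↦ (t : ℂ) ^ (-s)) (Ioi 1) :=
    integrableOn_Ioi_cpow_of_lt (by simpa using hs) one_pos
  have hfr : IntegrableOn
      (fun t : ℝ ↦ ((Int.fract t : ℝ) : ℂ) * (t : ℂ) ^ (-(s + 1))) (Ioi 1) := by
    have h : IntegrableOn (fun t : ℝ ↦ (t : ℂ) ^ (-(s + 1))) (Ioi 1) :=
      integrableOn_Ioi_cpow_of_lt (by simp; linarith) one_pos
    exact h.bdd_mul measurable_ofReal_fract.aestronglyMeasurable
      (Eventually.of_forall norm_ofReal_fract_le_one)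
  rw [← LSeries_one_eq_riemannZeta hs, LSeries_eq_mul_integral' 1 zero_le_one hs hO,
    fractMellin_eq_integral]
  have hcongr : ∫ t in Ioi (1 : ℝ), (∑ k ∈ Finset.Icc 1 ⌊t⌋₊, (1 : ℕ → ℂ) k) * (t : ℂ) ^ (-(s + 1))
      = ∫ t in Ioi (1 : ℝ),
        ((t : ℂ) ^ (-s) - ((Int.fract t : ℝ) : ℂ) * (t : ℂ) ^ (-(s + 1))) := by
    refine setIntegral_congr_fun measurableSet_Ioi fun t ht ↦ ?_
    have ht0 : 0 < t := one_pos.trans ht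
    have hfloor : ((⌊t⌋₊ : ℝ)) = t - Int.fract t := by
      rw [natCast_floor_eq_intCast_floor ht0.le, Int.self_sub_fract]
    have hfloor' : ((⌊t⌋₊ : ℂ)) = t - (Int.fract t : ℝ) := by
      rw [← Complex.ofReal_natCast, hfloor, Complex.ofReal_sub]
    have hmul : (t : ℂ) ^ (-s) = t * (t : ℂ) ^ (-(s + 1)) := by
      have ht' : (t : ℂ) ≠ 0 := by exact_mod_cast ht0.ne'
      rw [show -s = 1 + -(s + 1) by ring, Complex.cpow_add _ _ ht', Complex.cpow_one]
    simp only [Pi.one_apply, Finset.sum_const, Nat.card_Icc, add_tsub_cancel_right,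
      nsmul_eq_mul, mul_one]
    rw [hfloor', hmul]
    ring
  rw [hcongr, integral_sub hpow hfr, integral_Ioi_cpow_of_lt (by simpa using hs) one_pos]
  have hs1 : -s + 1 ≠ 0 := by
    rw [← neg_ne_zero]
    simpa [sub_eq_add_neg, add_comm] using hs0
  simp only [Complex.ofReal_one, Complex.one_cpow]
  field_simp
  grind

lemma riemannZeta₁_eq_sub_fractMellin {s : ℂ} (hs : 0 < s.re) :
    riemannZeta₁ s = s - s * (s - 1) * fractMellin s := by
  have hopen : IsOpen {s : ℂ | 0 < s.re} := isOpen_lt continuous_const Complex.continuous_re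
  have h₁ : AnalyticOnNhd ℂ riemannZeta₁ {s : ℂ | 0 < s.re} :=
    differentiable_riemannZeta₁.differentiableOn.analyticOnNhd hopen
  have h₂ : AnalyticOnNhd ℂ (fun s ↦ s - s * (s - 1) * fractMellin s) {s : ℂ | 0 < s.re} := by
    refine DifferentiableOn.analyticOnNhd (fun z hz ↦ ?_) hopen
    have := differentiableAt_fractMellin hz
    exact DifferentiableAt.differentiableWithinAt (by fun_prop)
  refine h₁.eqOn_of_preconnected_of_eventuallyEq h₂
    (convex_halfSpace_re_gt 0).isPreconnected (z₀ := 2) (by simp) ?_ hs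
  have hnear : ∀ᶠ z : ℂ in 𝓝 2, 1 < z.re :=
    Complex.continuous_re.continuousAt.eventually (eventually_gt_nhds (by norm_num))
  filter_upwards [hnear] with z hz
  have hz1 : z ≠ 1 := fun h ↦ by simp [h] at hz
  have hz0 : z - 1 ≠ 0 := sub_ne_zero.mpr hz1
  have h := riemannZeta_eq_inv_sub_mul hz1
  rw [riemannZeta_eq_sub_fractMellin hz] at h
  field_simp at h
  linear_combination -h

lemma norm_riemannZeta₁_le {s : ℂ} (hs : 1 / 4 ≤ s.re) :
    ‖riemannZeta₁ s‖ ≤ 5 * ‖s + 1‖ ^ 2 := by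
  have hs0 : 0 < s.re := by linarith
  have hnorm : ∀ x : ℝ, |x| ≤ 1 → ‖s + x‖ ≤ ‖s + 1‖ := fun x hx ↦ by
    rw [Complex.norm_def, Complex.norm_def]
    refine Real.sqrt_le_sqrt ?_
    have := abs_le.mp hx
    simp only [Complex.normSq_apply, Complex.add_re, Complex.add_im, Complex.ofReal_re,
      Complex.ofReal_im, Complex.one_re, Complex.one_im]
    nlinarith
  have h₀ : ‖s‖ ≤ ‖s + 1‖ := by simpa using hnorm 0 (by simp)
  have h₁ : ‖s - 1‖ ≤ ‖s + 1‖ := by simpa [sub_eq_add_neg] using hnorm (-1) (by simp)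
  have h₂ : 1 ≤ ‖s + 1‖ := by
    have := Complex.re_le_norm (s + 1)
    simp only [Complex.add_re, Complex.one_re] at this
    linarith
  have h₃ : ‖fractMellin s‖ ≤ 4 := (norm_fractMellin_le hs0).trans <| by
    rw [div_le_iff₀ hs0]
    linarith
  rw [riemannZeta₁_eq_sub_fractMellin hs0]
  calc ‖s - s * (s - 1) * fractMellin s‖ ≤ ‖s‖ + ‖s‖ * ‖s - 1‖ * ‖fractMellin s‖ := by
        simpa using norm_sub_le s (s * (s - 1) * fractMellin s)
    _ ≤ ‖s + 1‖ + ‖s + 1‖ * ‖s + 1‖ * 4 := by gcongr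
    _ ≤ 5 * ‖s + 1‖ ^ 2 := by nlinarith

open MeromorphicOn

/-- Jensen's inequality on the unit disc for finitely many zeros counted with multiplicity. -/
lemma sum_neg_log_norm_le_of_zeros {ι : Type*} {F : ℂ → ℂ} {M : ℝ}
    (hF : DifferentiableOn ℂ F (Metric.ball 0 1)) (hF₀ : F 0 ≠ 0) (hM : 1 ≤ M)
    (hbound : ∀ z ∈ Metric.ball (0 : ℂ) 1, ‖F z‖ ≤ M) (a : ι → ℂ) (S : Finset ι)
    (ha : ∀ i ∈ S, ‖a i‖ < 1 ∧ a i ≠ 0)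
    (hord : ∀ i ∈ S, (Nat.card {j : S // a j = a i} : ℕ∞) ≤ analyticOrderAt F (a i)) :
    ∑ i ∈ S, -Real.log ‖a i‖ ≤ Real.log M - Real.log ‖F 0‖ := by
  classical
  have hFan : AnalyticOnNhd ℂ F (Metric.ball 0 1) := hF.analyticOnNhd Metric.isOpen_ball
  have key : ∀ᶠ r : ℝ in 𝓝[<] 1,
      ∑ i ∈ S, (Real.log r - Real.log ‖a i‖) ≤ Real.log M - Real.log ‖F 0‖ := by
    have hev : ∀ᶠ r : ℝ in 𝓝[<] 1, ∀ i ∈ S, ‖a i‖ < r :=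
      (Finset.eventually_all S).mpr fun i hi ↦
        eventually_nhdsWithin_of_eventually_nhds (eventually_gt_nhds (ha i hi).1)
    have hev₀ : ∀ᶠ r : ℝ in 𝓝[<] 1, 0 < r :=
      eventually_nhdsWithin_of_eventually_nhds (eventually_gt_nhds one_pos)
    filter_upwards [hev, hev₀, self_mem_nhdsWithin] with r hr hr₀ hr₁
    have hsub : Metric.closedBall (0 : ℂ) |r| ⊆ Metric.ball 0 1 := by
      rw [abs_of_pos hr₀]
      exact Metric.closedBall_subset_ball hr₁
    have han : AnalyticOnNhd ℂ F (Metric.closedBall 0 |r|) := hFan.mono hsub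
    have hjensen := han.circleAverage_log_norm hr₀.ne' hF₀
    have havg : Real.circleAverage (fun z ↦ Real.log ‖F z‖) 0 r ≤ Real.log M := by
      refine Real.circleAverage_mono_on_of_le_circle
        (han.mono Metric.sphere_subset_closedBall).meromorphicOn.circleIntegrable_log_norm ?_
      intro z hz
      obtain h | h := eq_zero_or_norm_pos (F z)
      · simpa [h] using Real.log_nonneg hM
      · exact Real.log_le_log h (hbound z (hsub (Metric.sphere_subset_closedBall hz)))
    have hmem : ∀ i ∈ S, a i ∈ Metric.closedBall (0 : ℂ) |r| := fun i hi ↦ by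
      simpa [abs_of_pos hr₀] using (hr i hi).le
    have hdiv : ∀ i ∈ S, ((Finset.card {j ∈ S | a j = a i} : ℕ) : ℝ) ≤
        divisor F (Metric.closedBall 0 |r|) (a i) := by
      intro i hi
      have htop : analyticOrderAt F (a i) ≠ ⊤ :=
        hFan.analyticOrderAt_ne_top_of_isPreconnected (convex_ball _ _).isPreconnected
          (Metric.mem_ball_self one_pos) (hsub (hmem i hi))
          (by simp [(hFan 0 (by simp)).analyticOrderAt_eq_zero.mpr hF₀])
      have hcard : Nat.card {j : S // a j = a i} = Finset.card {j ∈ S | a j = a i} := by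
        rw [Nat.card_eq_fintype_card, Fintype.card_subtype, ← Finset.card_map
          (Function.Embedding.subtype (· ∈ S))]
        congr 1
        ext j
        simp [and_comm]
      have h := hord i hi
      rw [hcard] at h
      rw [han.divisor_apply (hmem i hi)]
      lift analyticOrderAt F (a i) to ℕ using htop with n
      simpa using h
    have hle : ∑ i ∈ S, (Real.log r - Real.log ‖a i‖) ≤
        ∑ᶠ u, divisor F (Metric.closedBall 0 |r|) u * Real.log (r * ‖0 - u‖⁻¹) := by
      have hfin : (Function.support fun u ↦
          (divisor F (Metric.closedBall 0 |r|) u : ℝ) * Real.log (r * ‖0 - u‖⁻¹)).Finite :=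
        ((divisor F (Metric.closedBall 0 |r|)).finiteSupport (isCompact_closedBall ..)).subset
          fun _ _ ↦ by simp_all
      have hnonneg : ∀ u, 0 ≤
          (divisor F (Metric.closedBall 0 |r|) u : ℝ) * Real.log (r * ‖0 - u‖⁻¹) := by
        intro u
        by_cases hu : u ∈ Metric.closedBall (0 : ℂ) |r|
        · refine mul_nonneg (mod_cast han.divisor_nonneg u) ?_
          obtain rfl | hu₀ := eq_or_ne u 0
          · simp
          refine Real.log_nonneg ?_
          rw [← div_eq_mul_inv, one_le_div (by simpa using hu₀)]
          simpa [abs_of_pos hr₀] using hu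
        · simp [hu]
      rw [finsum_eq_sum_of_support_subset (s := hfin.toFinset ∪ S.image a) _ (by simp)]
      refine le_trans ?_ (Finset.sum_le_sum_of_subset_of_nonneg Finset.subset_union_right
        fun u _ _ ↦ hnonneg u)
      rw [← Finset.sum_fiberwise_of_maps_to (t := S.image a) (g := a)
        fun i hi ↦ Finset.mem_image_of_mem a hi]
      refine Finset.sum_le_sum fun u hu ↦ ?_
      obtain ⟨i, hi, rfl⟩ := Finset.mem_image.mp hu
      have hpos : 0 < ‖a i‖ := norm_pos_iff.mpr (ha i hi).2
      have hlog : Real.log (r * ‖0 - a i‖⁻¹) = Real.log r - Real.log ‖a i‖ := by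
        rw [zero_sub, norm_neg, ← div_eq_mul_inv, Real.log_div hr₀.ne' hpos.ne']
      rw [Finset.sum_congr rfl (g := fun _ ↦ Real.log r - Real.log ‖a i‖)
        fun j hj ↦ by rw [(Finset.mem_filter.mp hj).2], Finset.sum_const, nsmul_eq_mul, hlog]
      exact mul_le_mul_of_nonneg_right (hdiv i hi)
        (sub_nonneg.mpr (Real.log_le_log hpos (hr i hi).le))
    linarith
  have hlim : Tendsto (fun r : ℝ ↦ ∑ i ∈ S, (Real.log r - Real.log ‖a i‖)) (𝓝[<] 1)
      (𝓝 (∑ i ∈ S, (Real.log 1 - Real.log ‖a i‖))) := by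
    refine tendsto_finsetSum _ fun i _ ↦ ?_
    exact ((Real.continuousAt_log one_ne_zero).tendsto.mono_left nhdsWithin_le_nhds).sub_const _
  simpa using le_of_tendsto hlim key

/-- The Cayley transform taking the unit disc to the half-plane `Re s > 1/4` and `0` to `1`. -/
noncomputable def discToHalfPlane (w : ℂ) : ℂ := (1 + w / 2) / (1 - w)

/-- The inverse of `discToHalfPlane`. -/
noncomputable def halfPlaneToDisc (s : ℂ) : ℂ := (s - 1) / (s + 1 / 2)

lemma one_sub_ne_zero_of_norm_lt_one {w : ℂ} (hw : ‖w‖ < 1) : 1 - w ≠ 0 := fun h ↦ by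
  rw [← sub_eq_zero.mp h, norm_one] at hw
  exact lt_irrefl _ hw

lemma re_discToHalfPlane_ge {w : ℂ} (hw : ‖w‖ < 1) : 1 / 4 ≤ (discToHalfPlane w).re := by
  have hw₁ := one_sub_ne_zero_of_norm_lt_one hw
  have hpos : 0 < Complex.normSq (1 - w) := Complex.normSq_pos.mpr hw₁
  have hw₂ : Complex.normSq w ≤ 1 := by
    rw [Complex.normSq_eq_norm_sq]
    exact pow_le_one₀ (norm_nonneg _) hw.le
  rw [discToHalfPlane, Complex.div_re, ← add_div, le_div_iff₀ hpos]
  simp [Complex.normSq_apply] at hw₂ ⊢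
  nlinarith

lemma add_half_ne_zero {s : ℂ} (hs : 1 / 4 < s.re) : s + 1 / 2 ≠ 0 := fun h ↦ by
  have := congrArg Complex.re h
  simp at this
  linarith

lemma discToHalfPlane_halfPlaneToDisc {s : ℂ} (hs : 1 / 4 < s.re) :
    discToHalfPlane (halfPlaneToDisc s) = s := by
  have h₁ := add_half_ne_zero hs
  have h₂ : 1 - halfPlaneToDisc s = (3 / 2) / (s + 1 / 2) := by
    rw [halfPlaneToDisc, eq_div_iff h₁, sub_mul, div_mul_cancel₀ _ h₁]
    ring
  have h₃ : 1 + halfPlaneToDisc s / 2 = (3 / 2 * s) / (s + 1 / 2) := by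
    rw [halfPlaneToDisc, eq_div_iff h₁, add_mul, div_right_comm, div_mul_cancel₀ _ h₁]
    ring
  rw [discToHalfPlane, h₂, h₃, div_div_div_cancel_right₀ h₁, mul_div_cancel_left₀ _ (by norm_num)]

lemma one_sub_norm_halfPlaneToDisc_sq {s : ℂ} (hs : 1 / 4 < s.re) :
    1 - ‖halfPlaneToDisc s‖ ^ 2 = 3 * (s.re - 1 / 4) / ‖s + 1 / 2‖ ^ 2 := by
  have h : ‖s + 1 / 2‖ ^ 2 ≠ 0 := by simpa using add_half_ne_zero hs
  rw [halfPlaneToDisc, norm_div, div_pow]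
  rw [eq_div_iff h, sub_mul, div_mul_cancel₀ _ h, ← Complex.normSq_eq_norm_sq,
    ← Complex.normSq_eq_norm_sq]
  simp [Complex.normSq_apply]
  ring

lemma norm_halfPlaneToDisc_lt_one {s : ℂ} (hs : 1 / 4 < s.re) : ‖halfPlaneToDisc s‖ < 1 := by
  have h : 0 < 1 - ‖halfPlaneToDisc s‖ ^ 2 := by
    have := norm_pos_iff.mpr (add_half_ne_zero hs)
    have := sub_pos.mpr hs
    rw [one_sub_norm_halfPlaneToDisc_sq hs]
    positivity
  nlinarith [norm_nonneg (halfPlaneToDisc s)]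

lemma analyticAt_discToHalfPlane {w : ℂ} (hw : ‖w‖ < 1) : AnalyticAt ℂ discToHalfPlane w := by
  have := one_sub_ne_zero_of_norm_lt_one hw
  unfold discToHalfPlane
  fun_prop (disch := assumption)

lemma discToHalfPlane_sub {w a : ℂ} (hw : ‖w‖ < 1) (ha : ‖a‖ < 1) :
    discToHalfPlane w - discToHalfPlane a = (w - a) * ((3 / 2) / ((1 - w) * (1 - a))) := by
  have := one_sub_ne_zero_of_norm_lt_one hw
  have := one_sub_ne_zero_of_norm_lt_one ha
  unfold discToHalfPlane
  field_simp
  ring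

/-- The normalisation of `(s - 1)ζ(s)` transported to the unit disc. -/
noncomputable def zetaDisc (w : ℂ) : ℂ :=
  riemannZeta₁ (discToHalfPlane w) / (discToHalfPlane w + 1) ^ 2

lemma discToHalfPlane_add_one_ne_zero {w : ℂ} (hw : ‖w‖ < 1) : discToHalfPlane w + 1 ≠ 0 :=
  fun h ↦ by
    have := congrArg Complex.re h
    simp at this
    linarith [re_discToHalfPlane_ge hw]

lemma analyticAt_zetaDisc {w : ℂ} (hw : ‖w‖ < 1) : AnalyticAt ℂ zetaDisc w := by
  have h := analyticAt_discToHalfPlane hw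
  exact ((differentiable_riemannZeta₁.analyticAt _).comp h).div ((h.add analyticAt_const).pow 2)
    (pow_ne_zero 2 (discToHalfPlane_add_one_ne_zero hw))

lemma norm_zetaDisc_le {w : ℂ} (hw : ‖w‖ < 1) : ‖zetaDisc w‖ ≤ 5 := by
  have h := norm_pos_iff.mpr (discToHalfPlane_add_one_ne_zero hw)
  rw [zetaDisc, norm_div, norm_pow, div_le_iff₀ (by positivity)]
  exact norm_riemannZeta₁_le (re_discToHalfPlane_ge hw)

lemma zetaDisc_zero : zetaDisc 0 = 1 / 4 := by
  norm_num [zetaDisc, discToHalfPlane]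

lemma ZeroOfOrder.le_analyticOrderAt_zetaDisc {z : ℂ} {m : ℕ} (hz : 1 / 4 < z.re) (hz₁ : z ≠ 1)
    (h : ZeroOfOrder riemannZeta z m) :
    (m : ℕ∞) ≤ analyticOrderAt zetaDisc (halfPlaneToDisc z) := by
  obtain ⟨g, hg, -, hfg⟩ := h
  set a := halfPlaneToDisc z with ha_def
  have ha : ‖a‖ < 1 := norm_halfPlaneToDisc_lt_one hz
  have hza : discToHalfPlane a = z := discToHalfPlane_halfPlaneToDisc hz
  have hφ := analyticAt_discToHalfPlane ha
  have hEq : ∀ᶠ w in 𝓝 z, riemannZeta w = (w - z) ^ m * g w := by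
    refine (ContinuousAt.eventuallyEq_nhds_iff_eventuallyEq_nhdsNE
      (differentiableAt_riemannZeta hz₁).continuousAt ?_).mp hfg
    have := hg.continuousAt
    fun_prop
  rw [natCast_le_analyticOrderAt (analyticAt_zetaDisc ha)]
  refine ⟨fun w ↦ ((3 / 2) / ((1 - w) * (1 - a))) ^ m * (discToHalfPlane w - 1) *
    g (discToHalfPlane w) / (discToHalfPlane w + 1) ^ 2, ?_, ?_⟩
  · have h₁ : (1 - a) * (1 - a) ≠ 0 :=
      mul_self_ne_zero.mpr (one_sub_ne_zero_of_norm_lt_one ha)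
    have h₂ : (discToHalfPlane a + 1) ^ 2 ≠ 0 :=
      pow_ne_zero 2 (discToHalfPlane_add_one_ne_zero ha)
    have h₃ : AnalyticAt ℂ (fun w ↦ g (discToHalfPlane w)) a :=
      AnalyticAt.comp (by rwa [hza]) hφ
    have h₄ : AnalyticAt ℂ (fun w ↦ (3 / 2) / ((1 - w) * (1 - a))) a :=
      analyticAt_const.div (by fun_prop) h₁
    exact (((h₄.pow m).mul (hφ.sub analyticAt_const)).mul h₃).div
      ((hφ.add analyticAt_const).pow 2) h₂
  · have hcont : Tendsto discToHalfPlane (𝓝 a) (𝓝 z) := hza ▸ hφ.continuousAt.tendsto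
    have hball : ∀ᶠ w in 𝓝 a, ‖w‖ < 1 := continuous_norm.continuousAt.eventually
      (eventually_lt_nhds ha)
    filter_upwards [hcont.eventually hEq, hcont.eventually_ne hz₁, hball] with w hw hw₁ hwn
    have hζ : riemannZeta₁ (discToHalfPlane w) =
        (discToHalfPlane w - 1) * riemannZeta (discToHalfPlane w) := by
      rw [riemannZeta_eq_inv_sub_mul hw₁, mul_inv_cancel_left₀ (sub_ne_zero.mpr hw₁)]
    rw [zetaDisc, hζ, hw, ← hza, discToHalfPlane_sub hwn ha, smul_eq_mul, mul_pow]
    ring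

lemma CriticalZeroEnumFor.finite_fiber {sν : ℕ → ℂ} (h : CriticalZeroEnumFor riemannZeta sν)
    (ν : ℕ) : Finite {j : ℕ // sν j = sν ν} := by
  obtain ⟨hre, him, hzero⟩ := h.1 ν
  by_contra hinf
  obtain ⟨g, hg, hg₀, hfg⟩ := h.2 _ hre him hzero
  have hne : sν ν ≠ 1 := fun h ↦ by simp [h] at him
  have : Infinite {j : ℕ // sν j = sν ν} := not_finite_iff_infinite.mp hinf
  simp only [Nat.card_eq_zero_of_infinite, pow_zero, one_mul] at hfg
  have hEq := (ContinuousAt.eventuallyEq_nhds_iff_eventuallyEq_nhdsNE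
    (differentiableAt_riemannZeta hne).continuousAt hg.continuousAt).mp hfg
  exact hg₀ (hEq.eq_of_nhds ▸ hzero)

lemma inv_norm_sq_le_neg_log {s : ℂ} (hs : s.re = 1 / 2) :
    (‖s‖ ^ 2)⁻¹ ≤ 32 / 3 * -Real.log ‖halfPlaneToDisc s‖ := by
  have hs' : 1 / 4 < s.re := by rw [hs]; norm_num
  have h₁ : s ≠ 1 := fun h ↦ by norm_num [h] at hs
  have ha : 0 < ‖halfPlaneToDisc s‖ :=
    norm_pos_iff.mpr (div_ne_zero (sub_ne_zero.mpr h₁) (add_half_ne_zero hs'))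
  have hlog := Real.log_le_sub_one_of_pos (pow_pos ha 2)
  rw [Real.log_pow] at hlog
  have hsq := one_sub_norm_halfPlaneToDisc_sq hs'
  have hhalf : 1 / 2 ≤ ‖s‖ := hs ▸ Complex.re_le_norm s
  have hpos := norm_pos_iff.mpr (add_half_ne_zero hs')
  have hle : ‖s + 1 / 2‖ ≤ 2 * ‖s‖ := by
    refine (norm_add_le _ _).trans ?_
    norm_num
    linarith
  have hinv : (3 / 16) * (‖s‖ ^ 2)⁻¹ ≤ 3 * (s.re - 1 / 4) / ‖s + 1 / 2‖ ^ 2 := by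
    have hs₀ : 0 < ‖s‖ := by linarith
    rw [hs, ← div_eq_mul_inv, div_le_div_iff₀ (by positivity) (by positivity)]
    nlinarith
  push_cast at hlog
  linarith

/-- The critical zeros satisfy the Blaschke condition for the half-plane `Re s > 1/4`. -/
lemma CriticalZeroEnumFor.summable_inv_norm_sq {sν : ℕ → ℂ}
    (h : CriticalZeroEnumFor riemannZeta sν) : Summable fun ν ↦ (‖sν ν‖ ^ 2)⁻¹ := by
  have hre : ∀ ν, 1 / 4 < (sν ν).re := fun ν ↦ by rw [(h.1 ν).1]; norm_num
  have hne : ∀ ν, sν ν ≠ 1 := fun ν h' ↦ by simpa [h'] using (h.1 ν).2.1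
  refine summable_of_sum_le (c := 32 / 3 * (Real.log 5 - Real.log ‖zetaDisc 0‖))
    (fun ν ↦ by positivity) fun S ↦ ?_
  refine (Finset.sum_le_sum fun ν _ ↦ inv_norm_sq_le_neg_log (h.1 ν).1).trans ?_
  rw [← Finset.mul_sum]
  refine mul_le_mul_of_nonneg_left ?_ (by norm_num)
  refine sum_neg_log_norm_le_of_zeros (a := fun ν ↦ halfPlaneToDisc (sν ν))
    (fun w hw ↦ (analyticAt_zetaDisc (by simpa using hw)).differentiableAt.differentiableWithinAt)
    (by rw [zetaDisc_zero]; norm_num) (by norm_num)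
    (fun w hw ↦ norm_zetaDisc_le (by simpa using hw)) S
    (fun ν _ ↦ ⟨norm_halfPlaneToDisc_lt_one (hre ν),
      div_ne_zero (sub_ne_zero.mpr (hne ν)) (add_half_ne_zero (hre ν))⟩) fun ν _ ↦ ?_
  obtain ⟨hν₁, hν₂, hν₃⟩ := h.1 ν
  refine le_trans ?_ ((h.2 _ hν₁ hν₂ hν₃).le_analyticOrderAt_zetaDisc (hre ν) (hne ν))
  have := h.finite_fiber ν
  refine Nat.cast_le.mpr (Nat.card_le_card_of_injective
    (fun j ↦ ⟨j.1.1, ?_⟩) fun i j hij ↦ ?_)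
  · rw [← discToHalfPlane_halfPlaneToDisc (hre j.1.1), j.2,
      discToHalfPlane_halfPlaneToDisc (hre ν)]
  · exact Subtype.ext (Subtype.ext (by simpa using hij))

lemma differentiable_hfun {sν : ℕ → ℂ} (hsum : Summable fun ν ↦ (‖sν ν‖ ^ 2)⁻¹) :
    Differentiable ℂ (hfun sν) := by
  have hloc : ∀ R : ℝ, DifferentiableOn ℂ
      (fun s ↦ ∏' ν, (1 + -((s - s ^ 2) / ((‖sν ν‖ : ℂ) ^ 2)))) (Metric.ball 0 R) := by
    intro R
    have hprod : HasProdLocallyUniformlyOn (fun ν s ↦ 1 + -((s - s ^ 2) / ((‖sν ν‖ : ℂ) ^ 2)))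
        (fun s ↦ ∏' ν, (1 + -((s - s ^ 2) / ((‖sν ν‖ : ℂ) ^ 2)))) (Metric.ball (0 : ℂ) R) := by
      refine Summable.hasProdLocallyUniformlyOn_one_add
        (u := fun ν ↦ (R + R ^ 2) * (‖sν ν‖ ^ 2)⁻¹) Metric.isOpen_ball (hsum.mul_left _)
        (Eventually.of_forall fun ν s hs ↦ ?_) fun ν ↦ by fun_prop
      have hs' : ‖s‖ ≤ R := by simpa using (Metric.mem_ball.mp hs).le
      have hle : ‖s - s ^ 2‖ ≤ R + R ^ 2 := by
        refine (norm_sub_le _ _).trans ?_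
        rw [norm_pow]
        gcongr
      rw [norm_neg, norm_div, norm_pow, Complex.norm_real, norm_norm, div_eq_mul_inv]
      gcongr
    refine hprod.tendstoLocallyUniformlyOn_finsetRange.differentiableOn
      (Eventually.of_forall fun n ↦ ?_) Metric.isOpen_ball
    fun_prop
  intro s
  have h := (hloc (‖s‖ + 1)).differentiableAt (Metric.isOpen_ball.mem_nhds (x := s) (by simp))
  have heq : hfun sν = fun s ↦ (1 / 2 : ℂ) *
      ∏' ν, (1 + -((s - s ^ 2) / ((‖sν ν‖ : ℂ) ^ 2))) := by
    funext s
    simp only [hfun, sub_eq_add_neg (1 : ℂ)]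
  rw [heq]
  exact h.const_mul _

lemma hfun_one (sν : ℕ → ℂ) : hfun sν 1 = 1 / 2 := by simp [hfun]

/-- The entire function extending `(s - 1) η(s)`. -/
noncomputable def etaExt (sν : ℕ → ℂ) (s : ℂ) : ℂ :=
  hfun sν s * (Real.pi : ℂ) ^ (s / 2) * (Complex.Gamma (s / 2 + 1))⁻¹

lemma differentiable_etaExt {sν : ℕ → ℂ} (hh : Differentiable ℂ (hfun sν)) :
    Differentiable ℂ (etaExt sν) := by
  have hπ : (Real.pi : ℂ) ≠ 0 := by exact_mod_cast Real.pi_ne_zero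
  have hΓ : Differentiable ℂ fun s : ℂ ↦ (Complex.Gamma (s / 2 + 1))⁻¹ :=
    Complex.differentiable_one_div_Gamma.comp (f := fun s : ℂ ↦ s / 2 + 1) (by fun_prop)
  have hpow : Differentiable ℂ fun s : ℂ ↦ (Real.pi : ℂ) ^ (s / 2) :=
    fun s ↦ DifferentiableAt.const_cpow (by fun_prop) (Or.inl hπ)
  exact (hh.mul hpow).mul hΓ

lemma etaExt_eq {sν : ℕ → ℂ} {s : ℂ} (h₁ : s ≠ 1) (h₀ : s ≠ 0) :
    etaExt sν s = (s - 1) * etaFun sν s := by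
  have hs : s - 1 ≠ 0 := sub_ne_zero.mpr h₁
  have hpow : (Real.pi : ℂ) ^ (-s / 2) = ((Real.pi : ℂ) ^ (s / 2))⁻¹ := by
    rw [neg_div, Complex.cpow_neg]
  rw [etaExt, etaFun, Complex.Gamma_add_one _ (by simpa using h₀), hpow]
  field_simp

lemma etaExt_one (sν : ℕ → ℂ) : etaExt sν 1 = 1 := by
  have hπ : (Real.pi : ℂ) ≠ 0 := by exact_mod_cast Real.pi_ne_zero
  have hpow : (Real.pi : ℂ) ^ (1 / 2 : ℂ) ≠ 0 := by simp [hπ]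
  rw [etaExt, hfun_one, Complex.Gamma_add_one _ (by norm_num), Complex.Gamma_one_half_eq]
  field_simp

/-- `η` has a simple pole at `s = 1` with residue `1`: `lim_{s→1} (s-1)η(s) = 1`;
moreover `(s-1)η(s)` extends to an entire function. -/
theorem etaFun_residue_one (sν : ℕ → ℂ)
    (henum : CriticalZeroEnumFor riemannZeta sν) :
    Tendsto (fun s : ℂ => (s - 1) * etaFun sν s) (𝓝[≠] 1) (𝓝 1) ∧
    ∃ F : ℂ → ℂ, Differentiable ℂ F ∧
      ∀ s : ℂ, s ≠ 1 → (∀ n : ℕ, s ≠ -2 * n) → F s = (s - 1) * etaFun sν s := by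
  have hdiff := differentiable_etaExt (differentiable_hfun henum.summable_inv_norm_sq)
  refine ⟨?_, etaExt sν, hdiff, fun s h₁ h₀ ↦ etaExt_eq h₁ (by simpa using h₀ 0)⟩
  have hlim : Tendsto (etaExt sν) (𝓝[≠] 1) (𝓝 1) := by
    simpa [etaExt_one] using (hdiff.continuous.tendsto 1).mono_left nhdsWithin_le_nhds
  refine hlim.congr' ?_
  filter_upwards [self_mem_nhdsWithin, eventually_nhdsWithin_of_eventually_nhds
    (eventually_ne_nhds one_ne_zero)] with s h₁ h₀ using etaExt_eq h₁ h₀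
end
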